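/- Let ξ₁,…,ξ_N be i.i.d. uniformly random points on S² (N sufficiently large). Then for all t ≥ 0, the probability that the convex hull [ξ₁,…,ξ_N] has a facet of 2-dimensional area at most t is at most 57π·N^{8/3}·t^{5/3}. -/

import Mathlib

open MeasureTheory Metric Real

/-- The uniform probability measure on the unit sphere `S² ⊂ ℝ³`. -/
noncomputable def sphereUniform3 : Measure (EuclideanSpace ℝ (Fin 3)) :=
  (μH[(2 : ℝ)] (sphere (0 : EuclideanSpace ℝ (Fin 3)) 1))⁻¹ •
    (μH[(2 : ℝ)]).restrict (sphere (0 : EuclideanSpace ℝ (Fin 3)) 1)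

/-- `F` is a facet (2-dimensional exposed face) of the polytope `P ⊆ ℝ³`. -/
def IsFacet3 (P F : Set (EuclideanSpace ℝ (Fin 3))) : Prop :=
  IsExposed ℝ P F ∧ Module.finrank ℝ (vectorSpan ℝ F) = 2

local notation "E3" => EuclideanSpace ℝ (Fin 3)

lemma measurePreserving_splitFirst :
    MeasurePreserving
      (fun y : E3 => ((y 0, WithLp.toLp 2 fun j : Fin 2 => y j.succ) :
        ℝ × EuclideanSpace ℝ (Fin 2))) volume volume := by
  have h1 := PiLp.volume_preserving_ofLp (Fin 3)
  have h2 := volume_preserving_piFinSuccAbove (fun _ : Fin 3 => ℝ) 0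
  have h3 : MeasurePreserving (Prod.map id (@WithLp.toLp 2 (Fin 2 → ℝ)))
      (volume : Measure (ℝ × (Fin 2 → ℝ))) (volume : Measure (ℝ × EuclideanSpace ℝ (Fin 2))) :=
    (MeasurePreserving.id volume).prod (PiLp.volume_preserving_toLp (Fin 2))
  exact h3.comp (h2.comp h1)

lemma volume_sector {s : ℝ} (hs0 : 0 ≤ s) (hs1 : s ≤ 1) :
    volume {y : E3 | ‖y‖ ≤ 1 ∧ s * ‖y‖ ≤ y 0} = ENNReal.ofReal (2 * π / 3 * (1 - s)) := by
  set S' : Set (ℝ × EuclideanSpace ℝ (Fin 2)) :=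
    {p | p.1 ^ 2 + ‖p.2‖ ^ 2 ≤ 1 ∧ s * √(p.1 ^ 2 + ‖p.2‖ ^ 2) ≤ p.1} with hS'
  have hmeas : MeasurableSet S' := by
    apply IsClosed.measurableSet
    apply IsClosed.inter
    · exact isClosed_le (f := fun p : ℝ × EuclideanSpace ℝ (Fin 2) => p.1 ^ 2 + ‖p.2‖ ^ 2)
        (by fun_prop) continuous_const
    · exact isClosed_le (f := fun p : ℝ × EuclideanSpace ℝ (Fin 2) => s * √(p.1 ^ 2 + ‖p.2‖ ^ 2))
        (by fun_prop) continuous_fst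
  have hpre : {y : E3 | ‖y‖ ≤ 1 ∧ s * ‖y‖ ≤ y 0} =
      (fun y : E3 => ((y 0, WithLp.toLp 2 fun j : Fin 2 => y j.succ) :
        ℝ × EuclideanSpace ℝ (Fin 2))) ⁻¹' S' := by
    ext y
    have hn : (y 0) ^ 2 + ‖(WithLp.toLp 2 fun j : Fin 2 => y j.succ : EuclideanSpace ℝ (Fin 2))‖ ^ 2
        = ‖y‖ ^ 2 := by
      rw [EuclideanSpace.real_norm_sq_eq, EuclideanSpace.real_norm_sq_eq, Fin.sum_univ_succ (n := 2)]
    simp only [hS', Set.mem_ofPred_eq, Set.mem_preimage]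
    rw [hn, Real.sqrt_sq (norm_nonneg _), sq_le_one_iff₀ (norm_nonneg _)]
  rw [hpre, measurePreserving_splitFirst.measure_preimage hmeas.nullMeasurableSet,
    Measure.volume_eq_prod, Measure.prod_apply hmeas]
  set g : ℝ → ℝ := fun z => if z < s then z ^ 2 * ((1 - s ^ 2) / s ^ 2) else 1 - z ^ 2 with hg
  have hs2 : 0 ≤ 1 - s ^ 2 := by nlinarith
  have hslice : ∀ z, volume (Prod.mk z ⁻¹' S') =
      (Set.Icc (0 : ℝ) 1).indicator (fun z => ENNReal.ofReal (π * g z)) z := by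
    intro z
    by_cases hz : z ∈ Set.Icc (0 : ℝ) 1
    · rw [Set.indicator_of_mem hz]
      obtain ⟨hz0, hz1⟩ := hz
      have hg0 : 0 ≤ g z := by
        simp only [hg]; split_ifs
        · positivity
        · nlinarith
      have : Prod.mk z ⁻¹' S' = closedBall (0 : EuclideanSpace ℝ (Fin 2)) (√(g z)) := by
        ext w
        simp only [hS', Set.mem_preimage, Set.mem_ofPred_eq, mem_closedBall, dist_zero_right]
        rw [Real.le_sqrt (norm_nonneg _) hg0]
        have hq : s * √(z ^ 2 + ‖w‖ ^ 2) ≤ z ↔ s ^ 2 * (z ^ 2 + ‖w‖ ^ 2) ≤ z ^ 2 := by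
          have hr : 0 ≤ z ^ 2 + ‖w‖ ^ 2 := by positivity
          rw [← pow_le_pow_iff_left₀ (mul_nonneg hs0 (Real.sqrt_nonneg _)) hz0 two_ne_zero,
            mul_pow, Real.sq_sqrt hr]
        rw [hq]
        simp only [hg]
        split_ifs with h
        · have hs : 0 < s := by linarith
          have : z ^ 2 * ((1 - s ^ 2) / s ^ 2) = (z ^ 2 * (1 - s ^ 2)) / s ^ 2 := by ring
          rw [this, le_div_iff₀ (by positivity)]
          constructor
          · rintro ⟨_, h2⟩; linarith
          · intro h2
            have h3 : s ^ 2 * (z ^ 2 + ‖w‖ ^ 2) ≤ z ^ 2 := by linarith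
            refine ⟨?_, h3⟩
            have : z ^ 2 ≤ s ^ 2 := by nlinarith
            have : s ^ 2 * (z ^ 2 + ‖w‖ ^ 2) ≤ s ^ 2 * 1 := by linarith
            exact le_of_mul_le_mul_left this (by positivity)
        · rw [not_lt] at h
          constructor
          · rintro ⟨h1, _⟩; linarith
          · intro h2
            have h3 : z ^ 2 + ‖w‖ ^ 2 ≤ 1 := by linarith
            refine ⟨h3, ?_⟩
            have : s ^ 2 ≤ z ^ 2 := by nlinarith
            nlinarith [sq_nonneg s]
      rw [this, EuclideanSpace.volume_closedBall_fin_two, ← ENNReal.ofReal_pow (by positivity),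
        Real.sq_sqrt hg0, mul_comm π, ENNReal.ofReal_mul hg0]
    · rw [Set.indicator_of_notMem hz]
      have : Prod.mk z ⁻¹' S' = ∅ := by
        ext w
        simp only [hS', Set.mem_preimage, Set.mem_ofPred_eq, Set.mem_empty_iff_false, iff_false]
        rintro ⟨h1, h2⟩
        apply hz
        have := mul_nonneg hs0 (Real.sqrt_nonneg (z ^ 2 + ‖w‖ ^ 2))
        exact ⟨by linarith, by nlinarith [sq_nonneg ‖w‖]⟩
      simp [this]
  simp_rw [hslice]
  rw [lintegral_indicator measurableSet_Icc, ← Set.Ico_union_Icc_eq_Icc hs0 hs1,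
    lintegral_union measurableSet_Icc
      (Set.disjoint_left.2 fun x hx hx' => not_le.2 hx.2 hx'.1)]
  have e1 : ∫⁻ z in Set.Ico 0 s, ENNReal.ofReal (π * g z) =
      ENNReal.ofReal (∫ z in (0 : ℝ)..s, π * (z ^ 2 * ((1 - s ^ 2) / s ^ 2))) := by
    rw [intervalIntegral.integral_of_le hs0, ← integral_Ico_eq_integral_Ioc,
      ofReal_integral_eq_lintegral_ofReal]
    · refine setLIntegral_congr_fun measurableSet_Ico fun z hz => ?_
      simp [hg, hz.2]
    · exact (Continuous.integrableOn_Icc (by fun_prop)).mono_set Set.Ico_subset_Icc_self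
    · exact ae_of_all _ fun z => by positivity
  have e2 : ∫⁻ z in Set.Icc s 1, ENNReal.ofReal (π * g z) =
      ENNReal.ofReal (∫ z in s..1, π * (1 - z ^ 2)) := by
    rw [intervalIntegral.integral_of_le hs1, ← integral_Icc_eq_integral_Ioc,
      ofReal_integral_eq_lintegral_ofReal]
    · refine setLIntegral_congr_fun measurableSet_Icc fun z hz => ?_
      simp [hg, not_lt.2 hz.1]
    · exact Continuous.integrableOn_Icc (by fun_prop)
    · refine (ae_restrict_iff' measurableSet_Icc).2 (ae_of_all _ fun z hz => ?_)
      have : 0 ≤ 1 - z ^ 2 := by nlinarith [hz.1, hz.2]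
      simp only [Pi.zero_apply]
      positivity
  have i1 : ∫ z in (0 : ℝ)..s, π * (z ^ 2 * ((1 - s ^ 2) / s ^ 2)) = π * (s * (1 - s ^ 2) / 3) := by
    rw [intervalIntegral.integral_const_mul, intervalIntegral.integral_mul_const, integral_pow]
    rcases eq_or_ne s 0 with rfl | h
    · simp
    · field_simp; norm_num; ring
  have i2 : ∫ z in s..1, π * (1 - z ^ 2) = π * (2 / 3 - s + s ^ 3 / 3) := by
    rw [intervalIntegral.integral_const_mul,
      intervalIntegral.integral_sub (by simp) (Continuous.intervalIntegrable (by fun_prop) _ _),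
      integral_pow, intervalIntegral.integral_const]
    simp only [smul_eq_mul]
    norm_num
    ring
  rw [e1, e2, i1, i2, ← ENNReal.ofReal_add (by positivity)]
  · congr 1; ring
  · have : 0 ≤ 2 / 3 - s + s ^ 3 / 3 := by nlinarith [mul_nonneg (sq_nonneg (1 - s)) (by linarith : 0 ≤ s + 2)]
    positivity

/-- A rotation-invariant probability measure on the unit sphere of `ℝ³`. -/
structure IsRotInvSphere (σ : Measure E3) : Prop where
  prob : IsProbabilityMeasure σ
  map_eq : ∀ g : E3 ≃ₗᵢ[ℝ] E3, σ.map g = σ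
  ae_norm : ∀ᵐ x ∂σ, ‖x‖ = 1

lemma exists_linearIsometryEquiv_apply_eq {v w : E3} (h : ‖v‖ = ‖w‖) :
    ∃ g : E3 ≃ₗᵢ[ℝ] E3, g v = w :=
  ⟨_, Submodule.reflection_sub h⟩

lemma volume_sector_dir {s : ℝ} (hs0 : 0 ≤ s) (hs1 : s ≤ 1) {e : E3} (he : ‖e‖ = 1) :
    volume {y : E3 | ‖y‖ ≤ 1 ∧ s * ‖y‖ ≤ inner ℝ e y} = ENNReal.ofReal (2 * π / 3 * (1 - s)) := by
  obtain ⟨g, hg⟩ := exists_linearIsometryEquiv_apply_eq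
    (v := EuclideanSpace.single (0 : Fin 3) (1 : ℝ)) (w := e) (by simp [he])
  have hm : MeasurableSet {y : E3 | ‖y‖ ≤ 1 ∧ s * ‖y‖ ≤ inner ℝ e y} := by
    apply MeasurableSet.inter
    · exact measurableSet_le (f := fun y : E3 => ‖y‖) (by fun_prop) (by fun_prop)
    · exact measurableSet_le (f := fun y : E3 => s * ‖y‖) (by fun_prop) (by fun_prop)
  rw [← volume_sector hs0 hs1, ← g.measurePreserving.measure_preimage hm.nullMeasurableSet]
  congr 1
  ext y
  simp only [Set.mem_preimage, Set.mem_ofPred_eq, g.norm_map]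
  rw [← hg, g.inner_map_map, EuclideanSpace.inner_single_left]
  simp

namespace IsRotInvSphere

variable {σ : Measure E3}

lemma measurePreserving (hσ : IsRotInvSphere σ) (g : E3 ≃ₗᵢ[ℝ] E3) : MeasurePreserving g σ σ :=
  ⟨g.continuous.measurable, hσ.map_eq g⟩

lemma measure_cap (hσ : IsRotInvSphere σ) {e : E3} (he : ‖e‖ = 1) {s : ℝ} (hs0 : 0 ≤ s)
    (hs1 : s ≤ 1) : σ {x | s ≤ inner ℝ e x} = ENNReal.ofReal ((1 - s) / 2) := by
  have := hσ.prob
  set lam : Measure E3 := volume.restrict (closedBall 0 1) with hlam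
  have hlam_univ : lam Set.univ = ENNReal.ofReal (4 * π / 3) := by
    rw [hlam, Measure.restrict_apply_univ, EuclideanSpace.volume_closedBall_fin_three]
    simp; ring_nf
  set S : Set (E3 × E3) := {p | s * ‖p.2‖ ≤ inner ℝ p.1 p.2} with hS
  have hmS : MeasurableSet S :=
    measurableSet_le (f := fun p : E3 × E3 => s * ‖p.2‖) (by fun_prop) (by fun_prop)
  have h1 : (σ.prod lam) S = ENNReal.ofReal (2 * π / 3 * (1 - s)) := by
    rw [Measure.prod_apply hmS]
    have : ∀ᵐ x ∂σ, lam (Prod.mk x ⁻¹' S) = ENNReal.ofReal (2 * π / 3 * (1 - s)) := by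
      filter_upwards [hσ.ae_norm] with x hx
      rw [hlam, Measure.restrict_apply (measurable_prodMk_left hmS), ← volume_sector_dir hs0 hs1 hx]
      congr 1
      ext y
      simp [hS, and_comm]
    rw [lintegral_congr_ae this]
    simp
  have h2 : (σ.prod lam) S = σ {x | s ≤ inner ℝ e x} * ENNReal.ofReal (4 * π / 3) := by
    rw [Measure.prod_apply_symm hmS, ← hlam_univ, ← lintegral_const]
    refine lintegral_congr_ae ?_
    have h0 : ∀ᵐ y ∂lam, y ≠ 0 := by
      refine ae_restrict_of_ae ?_
      rw [ae_iff]
      simp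
    filter_upwards [h0] with y hy
    have hy' : 0 < ‖y‖ := norm_pos_iff.2 hy
    obtain ⟨g, hg⟩ := exists_linearIsometryEquiv_apply_eq
      (v := e) (w := ‖y‖⁻¹ • y) (by rw [he, norm_smul, norm_inv, norm_norm, inv_mul_cancel₀ hy'.ne'])
    have hy2 : y = ‖y‖ • g e := by rw [hg, smul_smul, mul_inv_cancel₀ hy'.ne', one_smul]
    rw [← (hσ.measurePreserving g).measure_preimage
      (measurable_prodMk_right hmS).nullMeasurableSet]
    congr 1
    ext x
    simp only [Set.mem_preimage, Set.mem_ofPred_eq, hS]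
    have : inner ℝ (g x) y = ‖y‖ * inner ℝ e x := by
      conv_lhs => rw [hy2]
      rw [inner_smul_right, g.inner_map_map, real_inner_comm]
    rw [this, mul_comm s, mul_le_mul_iff_right₀ hy']
  have hpos : ENNReal.ofReal (4 * π / 3) ≠ 0 := by
    rw [Ne, ENNReal.ofReal_eq_zero, not_le]; positivity
  rw [← ENNReal.mul_left_inj hpos ENNReal.ofReal_ne_top, ← h2, h1,
    ← ENNReal.ofReal_mul (by linarith)]
  congr 1; ring

lemma map_inner_restrict (hσ : IsRotInvSphere σ) {e : E3} (he : ‖e‖ = 1) :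
    (σ.map fun x => inner ℝ e x).restrict (Set.Ici 0) =
      (2⁻¹ : ENNReal) • (volume.restrict (Set.Icc 0 1)) := by
  have := hσ.prob
  have hm : Measurable fun x : E3 => (inner ℝ e x : ℝ) := by fun_prop
  have : IsFiniteMeasure (σ.map fun x => (inner ℝ e x : ℝ)) :=
    Measure.isFiniteMeasure_map _ _
  have key : ∀ a : ℝ, 0 ≤ a → σ {x | a ≤ inner ℝ e x} = 2⁻¹ * volume (Set.Icc a 1) := by
    intro a ha
    rcases le_or_gt a 1 with h1 | h1
    · rw [hσ.measure_cap he ha h1, Real.volume_Icc, ENNReal.ofReal_div_of_pos two_pos,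
        ENNReal.div_eq_inv_mul]
      simp
    · rw [Set.Icc_eq_empty (not_le.2 h1)]
      simp only [measure_empty, mul_zero]
      have h2 := hσ.measure_cap he zero_le_one le_rfl
      simp only [sub_self, zero_div, ENNReal.ofReal_zero] at h2
      exact measure_mono_null (fun x hx => h1.le.trans hx) h2
  refine Measure.ext_of_Ici _ _ fun a => ?_
  rw [Measure.restrict_apply measurableSet_Ici, Set.Ici_inter_Ici,
    Measure.map_apply hm measurableSet_Ici, Measure.smul_apply,
    Measure.restrict_apply measurableSet_Ici, smul_eq_mul]
  refine (key _ le_sup_right).trans ?_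
  congr 2
  ext x
  simp only [Set.mem_Icc, Set.mem_inter_iff, Set.mem_Ici, sup_le_iff]
  tauto

/-- Archimedes' theorem: the height of a uniform point is uniform (upper half). -/
lemma lintegral_inner_le (hσ : IsRotInvSphere σ) {e : E3} (he : ‖e‖ = 1) {f : ℝ → ENNReal}
    (hf : Measurable f) {s : Set ℝ} (hs : MeasurableSet s) (hs0 : s ⊆ Set.Ici 0) :
    ∫⁻ x, s.indicator f (inner ℝ e x) ∂σ ≤ 2⁻¹ * ∫⁻ z in s, f z := by
  have hm : Measurable fun x : E3 => (inner ℝ e x : ℝ) := by fun_prop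
  rw [← lintegral_map (hf.indicator hs) hm]
  calc ∫⁻ z, s.indicator f z ∂(σ.map fun x => inner ℝ e x)
      = ∫⁻ z in Set.Ici 0, s.indicator f z ∂(σ.map fun x => inner ℝ e x) := by
        rw [← lintegral_indicator measurableSet_Ici, Set.indicator_indicator,
          Set.inter_eq_right.2 hs0]
    _ = 2⁻¹ * ∫⁻ z in Set.Icc 0 1, s.indicator f z := by
        rw [hσ.map_inner_restrict he, lintegral_smul_measure, smul_eq_mul]
    _ ≤ 2⁻¹ * ∫⁻ z, s.indicator f z := by
        gcongr
        exact Measure.restrict_le_self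
    _ = _ := by rw [lintegral_indicator hs]

end IsRotInvSphere

/-- The cross product on Euclidean space. -/
noncomputable def cross (x y : E3) : E3 :=
  !₂[x 1 * y 2 - x 2 * y 1, x 2 * y 0 - x 0 * y 2, x 0 * y 1 - x 1 * y 0]

lemma inner_eq_three (x y : E3) : inner ℝ x y = x 0 * y 0 + x 1 * y 1 + x 2 * y 2 := by
  rw [PiLp.inner_apply, Fin.sum_univ_three]
  simp [mul_comm]

lemma norm_sq_eq_three (x : E3) : ‖x‖ ^ 2 = x 0 * x 0 + x 1 * x 1 + x 2 * x 2 := by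
  rw [← real_inner_self_eq_norm_sq, inner_eq_three]

@[simp] lemma cross_zero (x y : E3) : cross x y 0 = x 1 * y 2 - x 2 * y 1 := rfl
@[simp] lemma cross_one (x y : E3) : cross x y 1 = x 2 * y 0 - x 0 * y 2 := rfl
@[simp] lemma cross_two (x y : E3) : cross x y 2 = x 0 * y 1 - x 1 * y 0 := rfl

lemma inner_cross_left (x y : E3) : inner ℝ (cross x y) x = 0 := by
  simp only [inner_eq_three, cross_zero, cross_one, cross_two]; ring

lemma inner_cross_right (x y : E3) : inner ℝ (cross x y) y = 0 := by
  simp only [inner_eq_three, cross_zero, cross_one, cross_two]; ring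

lemma norm_cross_sq (x y : E3) : ‖cross x y‖ ^ 2 = ‖x‖ ^ 2 * ‖y‖ ^ 2 - inner ℝ x y ^ 2 := by
  simp only [inner_eq_three, norm_sq_eq_three, cross_zero, cross_one, cross_two]; ring

lemma continuous_cross : Continuous fun p : E3 × E3 => cross p.1 p.2 := by
  refine (PiLp.continuous_toLp 2 _).comp (continuous_pi fun i => ?_)
  fin_cases i <;> simp <;> fun_prop

/-- The circumradius formula for a triangle inscribed in the unit sphere, in polynomial form. -/
lemma norm_cross_sq_sub_inner_sq {x y z : E3} (hx : ‖x‖ = 1) (hy : ‖y‖ = 1) (hz : ‖z‖ = 1) :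
    ‖cross (y - x) (z - x)‖ ^ 2 - inner ℝ (cross (y - x) (z - x)) x ^ 2 =
      ‖y - x‖ ^ 2 * ‖z - x‖ ^ 2 * ‖y - z‖ ^ 2 / 4 := by
  have h1 : ‖x‖ ^ 2 = 1 := by rw [hx]; norm_num
  have hp : 2 * inner ℝ x (y - x) = -‖y - x‖ ^ 2 := by
    have := norm_sub_sq_real y x
    rw [hx, hy] at this
    rw [inner_sub_right, real_inner_self_eq_norm_sq, hx, this, real_inner_comm]; ring
  have hq : 2 * inner ℝ x (z - x) = -‖z - x‖ ^ 2 := by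
    have := norm_sub_sq_real z x
    rw [hx, hz] at this
    rw [inner_sub_right, real_inner_self_eq_norm_sq, hx, this, real_inner_comm]; ring
  have hyz : y - z = (y - x) - (z - x) := by abel
  rw [hyz]
  generalize y - x = p at *
  generalize z - x = q at *
  have hA : ‖cross p q‖ ^ 2 * ‖x‖ ^ 2 - inner ℝ (cross p q) x ^ 2 =
      ‖q‖ ^ 2 * inner ℝ x p ^ 2 + ‖p‖ ^ 2 * inner ℝ x q ^ 2 -
        2 * inner ℝ x p * inner ℝ x q * inner ℝ p q := by
    simp only [inner_eq_three, norm_sq_eq_three, cross_zero, cross_one, cross_two]; ring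
  rw [h1, mul_one] at hA
  rw [hA, norm_sub_sq_real p q]
  have hp' : inner ℝ x p = -‖p‖ ^ 2 / 2 := by linarith
  have hq' : inner ℝ x q = -‖q‖ ^ 2 / 2 := by linarith
  rw [hp', hq']; ring

/-- Rotation about the axis `e` with cosine `c` and sine `s` (Rodrigues' formula). -/
noncomputable def rodrigues (e : E3) (c s : ℝ) : E3 →ₗ[ℝ] E3 where
  toFun x := c • x + s • cross e x + ((1 - c) * inner ℝ e x) • e
  map_add' x y := by
    ext i
    fin_cases i <;> simp [inner_add_right] <;> ring
  map_smul' a x := by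
    ext i
    fin_cases i <;> simp [inner_smul_right] <;> ring

lemma rodrigues_apply (e : E3) (c s : ℝ) (x : E3) :
    rodrigues e c s x = c • x + s • cross e x + ((1 - c) * inner ℝ e x) • e := rfl

lemma norm_rodrigues {e : E3} (he : ‖e‖ = 1) {c s : ℝ} (hcs : c ^ 2 + s ^ 2 = 1) (x : E3) :
    ‖rodrigues e c s x‖ = ‖x‖ := by
  rw [← sq_eq_sq₀ (norm_nonneg _) (norm_nonneg _)]
  have h2 := norm_cross_sq e x
  have h3 := inner_cross_left e x
  have h4 := inner_cross_right e x
  rw [rodrigues_apply, ← real_inner_self_eq_norm_sq]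
  simp only [inner_add_left, inner_add_right, inner_smul_left, inner_smul_right,
    real_inner_self_eq_norm_sq, real_inner_comm x e, real_inner_comm (cross e x), h3, h4, h2, he]
  simp only [conj_trivial]
  rw [real_inner_comm e x]
  linear_combination (‖x‖ ^ 2 - inner ℝ e x ^ 2) * hcs

lemma inner_rodrigues {e : E3} (he : ‖e‖ = 1) (c s : ℝ) (x : E3) :
    inner ℝ e (rodrigues e c s x) = inner ℝ e x := by
  rw [rodrigues_apply, inner_add_right, inner_add_right, inner_smul_right, inner_smul_right,
    inner_smul_right, real_inner_comm (cross e x) e, inner_cross_left, real_inner_self_eq_norm_sq, he]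
  ring

lemma norm_rodrigues_sub_sq {e : E3} (he : ‖e‖ = 1) (a b : ℝ) (x : E3) :
    ‖rodrigues e (cos a) (sin a) x - rodrigues e (cos b) (sin b) x‖ ^ 2 =
      4 * sin ((a - b) / 2) ^ 2 * (‖x‖ ^ 2 - inner ℝ e x ^ 2) := by
  have hd : rodrigues e (cos a) (sin a) x - rodrigues e (cos b) (sin b) x =
      (cos a - cos b) • x + (sin a - sin b) • cross e x -
        ((cos a - cos b) * inner ℝ e x) • e := by
    rw [rodrigues_apply, rodrigues_apply]; module
  have h2 := norm_cross_sq e x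
  have h3 := inner_cross_left e x
  have h4 := inner_cross_right e x
  have h5 : 4 * sin ((a - b) / 2) ^ 2 = (cos a - cos b) ^ 2 + (sin a - sin b) ^ 2 := by
    have e1 := sin_sq_eq_half_sub ((a - b) / 2)
    rw [show 2 * ((a - b) / 2) = a - b by ring, cos_sub] at e1
    nlinarith [sin_sq_add_cos_sq a, sin_sq_add_cos_sq b]
  rw [h5, hd, ← real_inner_self_eq_norm_sq]
  simp only [inner_add_left, inner_add_right, inner_sub_left, inner_sub_right, inner_smul_left,
    inner_smul_right, real_inner_self_eq_norm_sq, real_inner_comm x e,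
    real_inner_comm (cross e x), h3, h4, h2, he]
  simp only [conj_trivial]
  rw [real_inner_comm e x]
  ring

/-- Rotation by the angle `a` about the axis `e`, as a linear isometry equivalence. -/
noncomputable def axisRotation (e : E3) (he : ‖e‖ = 1) (a : ℝ) : E3 ≃ₗᵢ[ℝ] E3 :=
  LinearIsometry.toLinearIsometryEquiv
    ⟨rodrigues e (cos a) (sin a), norm_rodrigues he (cos_sq_add_sin_sq a)⟩ rfl

lemma axisRotation_apply (e : E3) (he : ‖e‖ = 1) (a : ℝ) (x : E3) :
    axisRotation e he a x = rodrigues e (cos a) (sin a) x := rfl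

lemma two_div_le_sin_pi_mul_div {l k : ℕ} (hl : 1 ≤ l) (hlk : l < k) :
    2 / (k : ℝ) ≤ sin (π * l / k) := by
  have hk : (0 : ℝ) < k := by exact_mod_cast (by omega : 0 < k)
  have main : ∀ m : ℕ, 1 ≤ m → 2 * m ≤ k → 2 / (k : ℝ) ≤ sin (π * m / k) := by
    intro m hm hmk
    have hm' : (1 : ℝ) ≤ m := by exact_mod_cast hm
    have hmk' : 2 * (m : ℝ) ≤ k := by exact_mod_cast hmk
    have h := mul_le_sin (x := π * m / k) (by positivity) (by
      rw [div_le_div_iff₀ hk two_pos]; nlinarith [pi_pos])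
    refine le_trans ?_ h
    have : 2 / π * (π * m / k) = 2 * m / k := by field_simp
    rw [this]
    gcongr
    linarith
  rcases le_or_gt (2 * l) k with h | h
  · exact main l hl h
  · have := main (k - l) (by omega) (by omega)
    rw [Nat.cast_sub hlk.le] at this
    rwa [show π * ((k : ℝ) - l) / k = π - π * l / k by field_simp, sin_pi_sub] at this

/-- The component of `x - b` orthogonal to `e`. -/
noncomputable def offAxis (e b x : E3) : E3 := (x - b) - (inner ℝ e (x - b) : ℝ) • e

lemma continuous_offAxis (e b : E3) : Continuous (offAxis e b) := by
  unfold offAxis; fun_prop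

lemma norm_cross_smul_sq {e : E3} (he : ‖e‖ = 1) (a : ℝ) (b x : E3) :
    ‖cross (a • e) (x - b)‖ ^ 2 = a ^ 2 * ‖offAxis e b x‖ ^ 2 := by
  rw [norm_cross_sq, offAxis]
  generalize x - b = y
  rw [norm_sub_sq_real, norm_smul, norm_smul, inner_smul_left,
    inner_smul_right, real_inner_comm e y, he]
  simp only [conj_trivial, mul_one, Real.norm_eq_abs, sq_abs]
  ring

/-- Among `k` equally spaced rotations of a point about `e`, at most one is close to a line
parallel to `e`. -/
lemma eq_of_offAxis_le {e b x : E3} (he : ‖e‖ = 1) (hx : ‖x‖ = 1) {k : ℕ} {V q : ℝ}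
    (hq : 0 < q) (hkV : k * V < 2 * q) (hz : inner ℝ e x ^ 2 ≤ 1 - q ^ 2)
    {i j : ℕ} (hi : i < k) (hj : j < k)
    (hVi : ‖offAxis e b (axisRotation e he (2 * π * i / k) x)‖ ≤ V)
    (hVj : ‖offAxis e b (axisRotation e he (2 * π * j / k) x)‖ ≤ V) : i = j := by
  have key : ∀ {i j : ℕ}, i < k → j < i →
      ‖offAxis e b (axisRotation e he (2 * π * i / k) x)‖ ≤ V →
      ‖offAxis e b (axisRotation e he (2 * π * j / k) x)‖ ≤ V → False := by
    intro i j hi hji h1 h2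
    have hk : (0 : ℝ) < k := by exact_mod_cast (by omega : 0 < k)
    have hV : 0 ≤ V := (norm_nonneg _).trans h1
    rw [axisRotation_apply] at h1 h2
    set y := rodrigues e (cos (2 * π * i / k)) (sin (2 * π * i / k)) x with hy
    set y' := rodrigues e (cos (2 * π * j / k)) (sin (2 * π * j / k)) x with hy'
    have hyy : y - y' = offAxis e b y - offAxis e b y' := by
      have : inner ℝ e (y - b) = inner ℝ e (y' - b) := by
        rw [inner_sub_right, inner_sub_right, hy, hy', inner_rodrigues he, inner_rodrigues he]
      rw [offAxis, offAxis, this]; abel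
    have h3 : ‖y - y'‖ ≤ 2 * V := by
      rw [hyy]; exact (norm_sub_le _ _).trans (by linarith)
    have h4 := norm_rodrigues_sub_sq he (2 * π * i / k) (2 * π * j / k) x
    rw [← hy, ← hy', hx] at h4
    have h5 := two_div_le_sin_pi_mul_div (l := i - j) (k := k) (by omega) (by omega)
    rw [Nat.cast_sub hji.le] at h5
    rw [show (2 * π * i / k - 2 * π * j / k) / 2 = π * ((i : ℝ) - j) / k by ring] at h4
    set S := sin (π * ((i : ℝ) - j) / k)
    have h6 : V < q * S := by
      have : V < q * (2 / k) := by
        rw [mul_div_assoc', lt_div_iff₀ hk]; linarith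
      exact this.trans_le (by gcongr)
    have h7 : V ^ 2 < (q * S) ^ 2 := by gcongr
    have h8 : ‖y - y'‖ ^ 2 ≤ (2 * V) ^ 2 := by gcongr
    have h9 : q ^ 2 * S ^ 2 ≤ (1 - inner ℝ e x ^ 2) * S ^ 2 := by
      gcongr; linarith
    nlinarith
  rcases lt_trichotomy i j with h | h | h
  · exact (key hj h hVj hVi).elim
  · exact h
  · exact (key hi h hVi hVj).elim

lemma IsRotInvSphere.mul_lintegral_strip_le {σ : Measure E3} (hσ : IsRotInvSphere σ) {e : E3}
    (he : ‖e‖ = 1) (b : E3) {k : ℕ} {V q : ℝ} (hq : 0 < q) (hkV : k * V < 2 * q)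
    {f : ℝ → ENNReal} (hf : Measurable f) {s : Set ℝ} (hs : MeasurableSet s)
    (hsq : ∀ z ∈ s, z ^ 2 ≤ 1 - q ^ 2) :
    k * ∫⁻ x, {x | ‖offAxis e b x‖ ≤ V}.indicator (fun x => s.indicator f (inner ℝ e x)) x ∂σ ≤
      ∫⁻ x, s.indicator f (inner ℝ e x) ∂σ := by
  set A : Set E3 := {x | ‖offAxis e b x‖ ≤ V} with hA
  have hAm : MeasurableSet A :=
    (isClosed_le (continuous_offAxis e b).norm continuous_const).measurableSet
  set F : E3 → ENNReal := A.indicator (fun x => s.indicator f (inner ℝ e x)) with hF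
  have hm : Measurable fun x : E3 => s.indicator f (inner ℝ e x) :=
    (hf.indicator hs).comp (by fun_prop)
  have hFm : Measurable F := hm.indicator hAm
  let R : ℕ → (E3 ≃ₗᵢ[ℝ] E3) := fun j => axisRotation e he (2 * π * j / k)
  calc k * ∫⁻ x, F x ∂σ = ∑ j ∈ Finset.range k, ∫⁻ x, F (R j x) ∂σ := by
        rw [Finset.sum_congr rfl fun j _ => (hσ.measurePreserving (R j)).lintegral_comp hFm]
        simp
    _ = ∫⁻ x, ∑ j ∈ Finset.range k, F (R j x) ∂σ := by
        rw [lintegral_finsetSum]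
        intro j _
        exact hFm.comp (R j).continuous.measurable
    _ ≤ _ := by
        refine lintegral_mono_ae ?_
        filter_upwards [hσ.ae_norm] with x hx
        have hinn : ∀ j, inner ℝ e (R j x) = inner ℝ e x := fun j => inner_rodrigues he _ _ x
        by_cases hzs : inner ℝ e x ∈ s
        · by_cases hex : ∃ j ∈ Finset.range k, R j x ∈ A
          · obtain ⟨j, hj, hjA⟩ := hex
            rw [Finset.sum_eq_single_of_mem j hj]
            · simp [hF, hjA, hinn]
            · intro i hi hij
              refine Set.indicator_of_notMem (fun hiA => hij ?_) _
              exact eq_of_offAxis_le he hx hq hkV (hsq _ hzs) (Finset.mem_range.1 hi)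
                (Finset.mem_range.1 hj) hiA hjA
          · push Not at hex
            rw [Finset.sum_eq_zero]
            · exact zero_le
            · intro j hj
              exact Set.indicator_of_notMem (hex j hj) _
        · rw [Finset.sum_eq_zero]
          · exact zero_le
          · intro j _
            simp [hF, Set.indicator, hinn, hzs]

/-- The normal vector of the plane through `x`, `y`, `z`; its length is twice the area of the
triangle. -/
noncomputable def triNormal (x y z : E3) : E3 := cross (y - x) (z - x)

/-- The triangle `x y z` is nondegenerate, has area at most `τ`, its longest side is `x y` and its
shortest side is `x z`. -/
def IsSmallTriangle (τ : ℝ) (x y z : E3) : Prop :=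
  triNormal x y z ≠ 0 ∧ ‖triNormal x y z‖ ≤ 2 * τ ∧
    ‖z - y‖ ≤ ‖y - x‖ ∧ ‖z - x‖ ≤ ‖z - y‖

/-- The squared radius of the circle in which the plane through `x`, `y`, `z` cuts the sphere. -/
noncomputable def radiusSq (x y z : E3) : ℝ :=
  1 - (inner ℝ (triNormal x y z) x / ‖triNormal x y z‖) ^ 2

namespace IsSmallTriangle

variable {τ : ℝ} {x y z : E3}

lemma norm_triNormal_pos (h : IsSmallTriangle τ x y z) : 0 < ‖triNormal x y z‖ :=
  norm_pos_iff.2 h.1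

lemma tau_pos (h : IsSmallTriangle τ x y z) : 0 < τ := by
  linarith [h.norm_triNormal_pos, h.2.1]

lemma side_pos (h : IsSmallTriangle τ x y z) : 0 < ‖y - x‖ := by
  rcases (norm_nonneg (y - x)).eq_or_lt with h0 | h0
  · exfalso
    have h1 := norm_cross_sq (y - x) (z - x)
    rw [← h0, norm_eq_zero.1 h0.symm] at h1
    simp only [inner_zero_left] at h1
    have := h.norm_triNormal_pos
    rw [triNormal, norm_eq_zero.1 h0.symm] at this
    nlinarith
  · exact h0

lemma half_le (h : IsSmallTriangle τ x y z) : ‖y - x‖ / 2 ≤ ‖z - y‖ := by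
  have : ‖y - x‖ ≤ ‖z - x‖ + ‖z - y‖ := by
    rw [show y - x = (z - x) - (z - y) by abel]; exact norm_sub_le _ _
  linarith [h.2.2.2]

lemma radiusSq_mul (h : IsSmallTriangle τ x y z) (hx : ‖x‖ = 1) (hy : ‖y‖ = 1) (hz : ‖z‖ = 1) :
    radiusSq x y z * ‖triNormal x y z‖ ^ 2 =
      ‖y - x‖ ^ 2 * ‖z - x‖ ^ 2 * ‖z - y‖ ^ 2 / 4 := by
  have h1 := h.norm_triNormal_pos
  rw [norm_sub_rev z y, ← norm_cross_sq_sub_inner_sq hx hy hz, radiusSq, ← triNormal]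
  field_simp

lemma radiusSq_nonneg (h : IsSmallTriangle τ x y z) (hx : ‖x‖ = 1) (hy : ‖y‖ = 1)
    (hz : ‖z‖ = 1) : 0 ≤ radiusSq x y z := by
  have h1 := h.norm_triNormal_pos
  have h2 := h.radiusSq_mul hx hy hz
  by_contra! h3
  have : radiusSq x y z * ‖triNormal x y z‖ ^ 2 < 0 := mul_neg_of_neg_of_pos h3 (by positivity)
  have : 0 ≤ ‖y - x‖ ^ 2 * ‖z - x‖ ^ 2 * ‖z - y‖ ^ 2 / 4 := by positivity
  linarith

lemma le_radiusSq_of_dist (h : IsSmallTriangle τ x y z) (hx : ‖x‖ = 1) (hy : ‖y‖ = 1)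
    (hz : ‖z‖ = 1) : ‖y - x‖ ^ 4 * ‖z - x‖ ^ 2 / (64 * τ ^ 2) ≤ radiusSq x y z := by
  have hτ := h.tau_pos
  have h2 := h.radiusSq_mul hx hy hz
  have h3 : radiusSq x y z * ‖triNormal x y z‖ ^ 2 ≤ radiusSq x y z * (2 * τ) ^ 2 := by
    have := h.radiusSq_nonneg hx hy hz
    have := h.2.1
    gcongr
  have h4 : (‖y - x‖ / 2) ^ 2 ≤ ‖z - y‖ ^ 2 := by
    have := h.half_le
    gcongr
  rw [div_le_iff₀ (by positivity)]
  have h5 : ‖y - x‖ ^ 2 * ‖z - x‖ ^ 2 * (‖y - x‖ / 2) ^ 2 ≤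
      ‖y - x‖ ^ 2 * ‖z - x‖ ^ 2 * ‖z - y‖ ^ 2 := by gcongr
  nlinarith

lemma side_sq_le_radiusSq (h : IsSmallTriangle τ x y z) (hx : ‖x‖ = 1) (hy : ‖y‖ = 1) :
    ‖y - x‖ ^ 2 / 4 ≤ radiusSq x y z := by
  have h1 := h.norm_triNormal_pos
  have h2 : inner ℝ (triNormal x y z) (y - x) = 0 := inner_cross_left _ _
  have h3 : 2 * inner ℝ (triNormal x y z) x = inner ℝ (triNormal x y z) (x + y) := by
    rw [inner_sub_right] at h2
    rw [inner_add_right]; linarith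
  have h4 : (inner ℝ (triNormal x y z) (x + y)) ^ 2 ≤ (‖triNormal x y z‖ * ‖x + y‖) ^ 2 :=
    sq_le_sq' (neg_le_of_abs_le (abs_real_inner_le_norm _ _)) (real_inner_le_norm _ _)
  have h5 : ‖x + y‖ ^ 2 = 4 - ‖y - x‖ ^ 2 := by
    rw [norm_add_sq_real, norm_sub_sq_real, hx, hy, real_inner_comm]; ring
  have h6 : (inner ℝ (triNormal x y z) x / ‖triNormal x y z‖) ^ 2 ≤ (4 - ‖y - x‖ ^ 2) / 4 := by
    rw [div_pow, div_le_div_iff₀ (by positivity) (by norm_num), ← h5]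
    rw [← h3] at h4
    nlinarith
  rw [radiusSq]; linarith

lemma dist_le (h : IsSmallTriangle τ x y z) (hx : ‖x‖ = 1) (hy : ‖y‖ = 1)
    (hz : ‖z‖ = 1) (ha : 1 ≤ ‖y - x‖) : ‖z - x‖ ≤ 8 * τ := by
  have hτ := h.tau_pos
  have h1 := h.le_radiusSq_of_dist hx hy hz
  have h2 : radiusSq x y z ≤ 1 := by
    rw [radiusSq]; linarith [sq_nonneg (inner ℝ (triNormal x y z) x / ‖triNormal x y z‖)]
  have h3 := h1.trans h2
  rw [div_le_one (by positivity)] at h3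
  have h4 : 1 ≤ ‖y - x‖ ^ 4 := one_le_pow₀ ha
  have h5 : ‖z - x‖ ^ 2 ≤ (8 * τ) ^ 2 := by nlinarith [sq_nonneg ‖z - x‖]
  exact (pow_le_pow_iff_left₀ (norm_nonneg _) (by positivity) two_ne_zero).1 h5

end IsSmallTriangle

/-- The unit vector pointing from `y` to `x`. -/
noncomputable def sideDir (x y : E3) : E3 := ‖y - x‖⁻¹ • (x - y)

lemma norm_sideDir {x y : E3} (h : 0 < ‖y - x‖) : ‖sideDir x y‖ = 1 := by
  rw [sideDir, norm_smul, norm_inv, norm_norm, norm_sub_rev x y, inv_mul_cancel₀ h.ne']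

lemma inner_sideDir_self {x y : E3} (hx : ‖x‖ = 1) (hy : ‖y‖ = 1) (h : 0 < ‖y - x‖) :
    inner ℝ (sideDir x y) x = ‖y - x‖ / 2 := by
  have h1 := norm_sub_sq_real y x
  rw [sideDir, inner_smul_left, inner_sub_left, real_inner_self_eq_norm_sq]
  rw [hx, hy] at h1
  simp only [conj_trivial]
  field_simp
  rw [hx]; linarith

namespace IsSmallTriangle

variable {τ : ℝ} {x y z : E3}

lemma inner_sideDir_mem (h : IsSmallTriangle τ x y z) (hx : ‖x‖ = 1) (hy : ‖y‖ = 1) :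
    inner ℝ (sideDir x y) z ∈ Set.Icc 0 (‖y - x‖ / 2) := by
  have h0 := h.side_pos
  have h1 : ‖z - x‖ ^ 2 ≤ ‖z - y‖ ^ 2 := by have := h.2.2.2; gcongr
  have h2 : ‖z - y‖ ^ 2 ≤ ‖y - x‖ ^ 2 := by have := h.2.2.1; gcongr
  rw [norm_sub_sq_real, norm_sub_sq_real z y, hx, hy] at h1
  constructor
  · rw [sideDir, inner_smul_left, inner_sub_left, real_inner_comm, real_inner_comm z y]
    simp only [conj_trivial]
    refine mul_nonneg (by positivity) (by linarith)
  · have h3 : inner ℝ (x - y) (z - x) ≤ 0 := by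
      have : ‖z - y‖ ^ 2 = ‖z - x‖ ^ 2 + 2 * inner ℝ (x - y) (z - x) + ‖y - x‖ ^ 2 := by
        rw [show z - y = (z - x) + (x - y) by abel, norm_add_sq_real, real_inner_comm,
          norm_sub_rev x y]
      nlinarith [sq_nonneg ‖z - x‖]
    have h4 : inner ℝ (sideDir x y) (z - x) ≤ 0 := by
      rw [sideDir, inner_smul_left]
      simp only [conj_trivial]
      exact mul_nonpos_of_nonneg_of_nonpos (by positivity) h3
    rw [inner_sub_right, inner_sideDir_self hx hy h0] at h4
    linarith

lemma le_radiusSq_of_height (h : IsSmallTriangle τ x y z) (hx : ‖x‖ = 1) (hy : ‖y‖ = 1)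
    (hz : ‖z‖ = 1) :
    ‖y - x‖ ^ 4 * (‖y - x‖ / 2 - inner ℝ (sideDir x y) z) ^ 2 / (64 * τ ^ 2) ≤
      radiusSq x y z := by
  refine le_trans ?_ (h.le_radiusSq_of_dist hx hy hz)
  have h0 := h.side_pos
  have h1 : (‖y - x‖ / 2 - inner ℝ (sideDir x y) z) ^ 2 ≤ ‖z - x‖ ^ 2 := by
    rw [← inner_sideDir_self hx hy h0, ← inner_sub_right, norm_sub_rev z x]
    have := abs_real_inner_le_norm (sideDir x y) (x - z)
    rw [norm_sideDir h0, one_mul] at this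
    exact sq_le_sq' (neg_le_of_abs_le this) (le_of_abs_le this)
  gcongr

lemma norm_offAxis_le (h : IsSmallTriangle τ x y z) :
    ‖offAxis (sideDir x y) x z‖ ≤ 2 * τ / ‖y - x‖ := by
  have h0 := h.side_pos
  have h1 := norm_cross_smul_sq (norm_sideDir h0) (-‖y - x‖) x z
  have h2 : (-‖y - x‖) • sideDir x y = y - x := by
    rw [sideDir, smul_smul, neg_mul, mul_inv_cancel₀ h0.ne', neg_one_smul, neg_sub]
  rw [h2, ← triNormal, ← mul_pow, sq_eq_sq_iff_abs_eq_abs, abs_mul, abs_neg, abs_norm, abs_norm,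
    abs_norm] at h1
  rw [le_div_iff₀ h0, mul_comm, ← h1]
  exact h.2.1

end IsSmallTriangle

open Classical in
/-- The bound for the probability that `M` independent uniform points all lie on the same side of
the plane through a small triangle, and zero if the triangle is not small. -/
noncomputable def triWeight (M : ℕ) (τ : ℝ) (x y z : E3) : ENNReal :=
  if IsSmallTriangle τ x y z then ENNReal.ofReal (2 * exp (-(M * radiusSq x y z / 4))) else 0

lemma ENNReal.le_ofReal_inv_mul_of_mul_le {k : ℕ} (hk : 0 < k) {c : ℝ} (hc : 1 / (k : ℝ) ≤ c)
    {a b : ENNReal} (h : k * a ≤ b) : a ≤ ENNReal.ofReal c * b := by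
  have hk' : (0 : ℝ) < k := by exact_mod_cast hk
  calc a = ENNReal.ofReal (1 / (k : ℝ)) * (k * a) := by
        rw [← mul_assoc, ← ENNReal.ofReal_natCast, ← ENNReal.ofReal_mul (by positivity),
          one_div, inv_mul_cancel₀ hk'.ne', ENNReal.ofReal_one, one_mul]
    _ ≤ ENNReal.ofReal c * b := by gcongr

namespace IsRotInvSphere

variable {σ : Measure E3}

lemma lintegral_strip_le (hσ : IsRotInvSphere σ) {e : E3} (he : ‖e‖ = 1) (b : E3) {V q : ℝ}
    (hq : 0 < q) (hV : 0 < V)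
    {f : ℝ → ENNReal} (hf : Measurable f) {s : Set ℝ} (hs : MeasurableSet s)
    (hsq : ∀ z ∈ s, z ^ 2 ≤ 1 - q ^ 2) :
    ∫⁻ x, {x | ‖offAxis e b x‖ ≤ V}.indicator (fun x => s.indicator f (inner ℝ e x)) x ∂σ ≤
      ENNReal.ofReal (V / q) * ∫⁻ x, s.indicator f (inner ℝ e x) ∂σ := by
  set X := 2 * q / V with hX
  have hX0 : 0 < X := by positivity
  rcases le_or_gt X 1 with h | h
  · calc _ ≤ ∫⁻ x, s.indicator f (inner ℝ e x) ∂σ :=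
          lintegral_mono fun x => Set.indicator_le_self _ _ x
      _ ≤ _ := by
        refine le_mul_of_one_le_left zero_le ?_
        rw [ENNReal.one_le_ofReal, one_le_div hq]
        rw [hX, div_le_one hV] at h
        linarith
  · set k := ⌈X⌉₊ - 1 with hk
    have h2 : 1 < ⌈X⌉₊ := by rw [Nat.lt_ceil]; exact_mod_cast h
    have h3 : (k : ℝ) = ⌈X⌉₊ - 1 := by rw [hk, Nat.cast_sub h2.le]; simp
    have h4 : (k : ℝ) < X := by
      have := Nat.ceil_lt_add_one hX0.le
      linarith
    have h5 : 1 ≤ k := by omega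
    have h5' : (1 : ℝ) ≤ k := by exact_mod_cast h5
    have h6 : X / 2 ≤ k := by
      have := Nat.le_ceil X
      rcases le_or_gt X 2 with h7 | h7 <;> linarith
    refine ENNReal.le_ofReal_inv_mul_of_mul_le h5 ?_
      (hσ.mul_lintegral_strip_le he b hq ?_ hf hs hsq)
    · rw [div_le_iff₀ (by linarith)]
      have : V / q * (X / 2) = 1 := by rw [hX]; field_simp
      rw [← this]
      gcongr
    · rwa [hX, lt_div_iff₀ hV] at h4

/-- Decomposition of the weight into a strip condition and a function of the height. -/
lemma lintegral_triWeight_le_height (hσ : IsRotInvSphere σ) (M : ℕ) {τ : ℝ} (hτ : 0 < τ)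
    {x y : E3} (hx : ‖x‖ = 1) (hy : ‖y‖ = 1) (ha0 : 0 < ‖y - x‖) (ha1 : ‖y - x‖ ≤ 1) :
    ∫⁻ z, triWeight M τ x y z ∂σ ≤ ENNReal.ofReal (5 * τ / (2 * ‖y - x‖)) *
      ∫⁻ u in Set.Icc 0 (‖y - x‖ / 2), ENNReal.ofReal
        (exp (-(M * ‖y - x‖ ^ 4 / (256 * τ ^ 2)) * (‖y - x‖ / 2 - u) ^ 2)) := by
  set a := ‖y - x‖ with ha
  set f : ℝ → ENNReal := fun u => ENNReal.ofReal
        (exp (-(M * a ^ 4 / (256 * τ ^ 2)) * (a / 2 - u) ^ 2)) with hf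
  have hfm : Measurable f := by rw [hf]; fun_prop
  set s := Set.Icc 0 (a / 2) with hs
  have he := norm_sideDir (x := x) (y := y) ha0
  calc ∫⁻ z, triWeight M τ x y z ∂σ
      ≤ ∫⁻ z, {z | ‖offAxis (sideDir x y) x z‖ ≤ 2 * τ / a}.indicator
          (fun z => s.indicator (fun u => 2 * f u) (inner ℝ (sideDir x y) z)) z ∂σ := by
        refine lintegral_mono_ae ?_
        filter_upwards [hσ.ae_norm] with z hz
        rw [triWeight]
        split_ifs with h
        · rw [Set.indicator_of_mem (by exact h.norm_offAxis_le),
            Set.indicator_of_mem (h.inner_sideDir_mem hx hy), hf,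
            ENNReal.ofReal_mul (by norm_num), ENNReal.ofReal_ofNat]
          refine mul_le_mul_right (ENNReal.ofReal_le_ofReal (exp_le_exp.2 ?_)) _
          have := h.le_radiusSq_of_height hx hy hz
          rw [← ha] at this
          rw [neg_mul]
          refine neg_le_neg ?_
          calc M * a ^ 4 / (256 * τ ^ 2) * (a / 2 - inner ℝ (sideDir x y) z) ^ 2
              = M * (a ^ 4 * (a / 2 - inner ℝ (sideDir x y) z) ^ 2 / (64 * τ ^ 2)) / 4 := by
                field_simp; ring
            _ ≤ _ := by gcongr
        · exact zero_le
    _ ≤ ENNReal.ofReal (2 * τ / a / (4 / 5)) *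
          ∫⁻ z, s.indicator (fun u => 2 * f u) (inner ℝ (sideDir x y) z) ∂σ := by
        refine hσ.lintegral_strip_le he x (by norm_num) (by positivity) (hfm.const_mul 2)
          measurableSet_Icc fun z hz => ?_
        have := hz.1
        have := hz.2
        nlinarith
    _ ≤ ENNReal.ofReal (2 * τ / a / (4 / 5)) * (2⁻¹ * ∫⁻ u in s, 2 * f u) := by
        gcongr
        exact hσ.lintegral_inner_le he (hfm.const_mul 2) measurableSet_Icc fun z hz => hz.1
    _ = _ := by
        rw [lintegral_const_mul _ hfm, ← mul_assoc 2⁻¹, ENNReal.inv_mul_cancel (by simp) (by simp),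
          one_mul]
        congr 2
        field_simp; norm_num

lemma lintegral_triWeight_le_const (hσ : IsRotInvSphere σ) (M : ℕ) {τ : ℝ} (hτ : 0 < τ)
    {x y : E3} (hx : ‖x‖ = 1) (hy : ‖y‖ = 1) (ha1 : ‖y - x‖ ≤ 1) :
    ∫⁻ z, triWeight M τ x y z ∂σ ≤ ENNReal.ofReal (5 * τ / 4) := by
  rcases (norm_nonneg (y - x)).eq_or_lt with ha0 | ha0
  · have : ∀ z, triWeight M τ x y z = 0 := fun z => by
      rw [triWeight, if_neg]
      exact fun h => h.side_pos.ne ha0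
    simp [this]
  · refine (hσ.lintegral_triWeight_le_height M hτ hx hy ha0 ha1).trans ?_
    set a := ‖y - x‖
    calc _ ≤ ENNReal.ofReal (5 * τ / (2 * a)) * ∫⁻ u in Set.Icc 0 (a / 2), 1 := by
          gcongr with u
          rw [ENNReal.ofReal_le_one, exp_le_one_iff, neg_mul, Left.neg_nonpos_iff]
          positivity
      _ = _ := by
          rw [lintegral_const, one_mul, Measure.restrict_apply_univ, Real.volume_Icc, sub_zero,
            ← ENNReal.ofReal_mul (by positivity)]
          congr 1
          field_simp; norm_num

lemma lintegral_triWeight_le_cube (hσ : IsRotInvSphere σ) {M : ℕ} (hM : 0 < M) {τ : ℝ}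
    (hτ : 0 < τ) {x y : E3} (hx : ‖x‖ = 1) (hy : ‖y‖ = 1) (ha0 : 0 < ‖y - x‖)
    (ha1 : ‖y - x‖ ≤ 1) :
    ∫⁻ z, triWeight M τ x y z ∂σ ≤ ENNReal.ofReal (80 * τ ^ 2 / √M / ‖y - x‖ ^ 3) := by
  refine (hσ.lintegral_triWeight_le_height M hτ hx hy ha0 ha1).trans ?_
  set a := ‖y - x‖
  have hM' : (0 : ℝ) < M := by exact_mod_cast hM
  set β : ℝ := M * a ^ 4 / (256 * τ ^ 2) with hβ
  have hβ0 : 0 < β := by positivity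
  have hsqrt : √(π / β) ≤ 32 * τ / (√M * a ^ 2) := by
    rw [Real.sqrt_le_left (by positivity), hβ, div_pow, mul_pow, mul_pow, Real.sq_sqrt hM'.le,
      div_div_eq_mul_div, div_le_div_iff₀ (by positivity) (by positivity)]
    have : 0 < M * a ^ 4 * τ ^ 2 := by positivity
    nlinarith [pi_lt_four]
  calc _ ≤ ENNReal.ofReal (5 * τ / (2 * a)) *
            ∫⁻ u, ENNReal.ofReal (exp (-β * (a / 2 - u) ^ 2)) := by
          gcongr
          exact Measure.restrict_le_self
    _ = ENNReal.ofReal (5 * τ / (2 * a)) * ∫⁻ u, ENNReal.ofReal (exp (-β * u ^ 2)) := by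
          rw [lintegral_sub_left_eq_self (fun u => ENNReal.ofReal (exp (-β * u ^ 2)))]
    _ = ENNReal.ofReal (5 * τ / (2 * a)) * ENNReal.ofReal √(π / β) := by
          rw [← integral_gaussian, ofReal_integral_eq_lintegral_ofReal
            (integrable_exp_neg_mul_sq hβ0) (ae_of_all _ fun u => (exp_pos _).le)]
    _ ≤ ENNReal.ofReal (5 * τ / (2 * a)) * ENNReal.ofReal (32 * τ / (√M * a ^ 2)) := by gcongr
    _ = _ := by
          rw [← ENNReal.ofReal_mul (by positivity)]
          congr 1
          field_simp; norm_num

lemma norm_sub_sq_eq {x z : E3} (hx : ‖x‖ = 1) (hz : ‖z‖ = 1) :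
    ‖z - x‖ ^ 2 = 2 * (1 - inner ℝ x z) := by
  rw [norm_sub_sq_real, hx, hz, real_inner_comm]; ring

lemma measure_ball_le (hσ : IsRotInvSphere σ) {x : E3} (hx : ‖x‖ = 1) (ρ : ℝ) :
    σ {z | ‖z - x‖ ≤ ρ} ≤ ENNReal.ofReal (ρ ^ 2 / 2) := by
  have := hσ.prob
  rcases le_or_gt (ρ ^ 2) 2 with h | h
  · calc σ {z | ‖z - x‖ ≤ ρ} ≤ σ {z | 1 - ρ ^ 2 / 2 ≤ inner ℝ x z} := by
          refine measure_mono_ae ?_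
          filter_upwards [hσ.ae_norm] with z hz hzx
          have h1 := norm_sub_sq_eq hx hz
          have h2 : ‖z - x‖ ^ 2 ≤ ρ ^ 2 := by
            have : ‖z - x‖ ≤ ρ := hzx
            gcongr
          show 1 - ρ ^ 2 / 2 ≤ inner ℝ x z
          linarith
      _ = ENNReal.ofReal ((1 - (1 - ρ ^ 2 / 2)) / 2) :=
          hσ.measure_cap hx (by linarith) (by linarith [sq_nonneg ρ])
      _ ≤ _ := ENNReal.ofReal_le_ofReal (by linarith [sq_nonneg ρ])
  · refine prob_le_one.trans ?_
    rw [ENNReal.one_le_ofReal]; linarith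

lemma lintegral_triWeight_le_far (hσ : IsRotInvSphere σ) (M : ℕ) (τ : ℝ)
    {x y : E3} (hx : ‖x‖ = 1) (hy : ‖y‖ = 1) (ha : 1 ≤ ‖y - x‖) :
    ∫⁻ z, triWeight M τ x y z ∂σ ≤ ENNReal.ofReal (64 * τ ^ 2 * exp (-(M / 16))) := by
  have hm : MeasurableSet {z : E3 | ‖z - x‖ ≤ 8 * τ} :=
    measurableSet_le (f := fun z : E3 => ‖z - x‖) (by fun_prop) (by fun_prop)
  calc ∫⁻ z, triWeight M τ x y z ∂σ
      ≤ ∫⁻ z, {z : E3 | ‖z - x‖ ≤ 8 * τ}.indicator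
          (fun _ => ENNReal.ofReal (2 * exp (-(M / 16)))) z ∂σ := by
        refine lintegral_mono_ae ?_
        filter_upwards [hσ.ae_norm] with z hz
        rw [triWeight]
        split_ifs with h
        · rw [Set.indicator_of_mem (by exact h.dist_le hx hy hz ha)]
          refine ENNReal.ofReal_le_ofReal
            (mul_le_mul_of_nonneg_left (exp_le_exp.2 (neg_le_neg ?_)) (by norm_num))
          have h1 := h.side_sq_le_radiusSq hx hy
          have h2 : 1 ≤ ‖y - x‖ ^ 2 := one_le_pow₀ ha
          have h3 : 1 / 4 ≤ radiusSq x y z := by linarith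
          have h4 : (0 : ℝ) ≤ M := by positivity
          nlinarith
        · exact zero_le
    _ = ENNReal.ofReal (2 * exp (-(M / 16))) * σ {z : E3 | ‖z - x‖ ≤ 8 * τ} :=
        lintegral_indicator_const hm _
    _ ≤ ENNReal.ofReal (2 * exp (-(M / 16))) * ENNReal.ofReal ((8 * τ) ^ 2 / 2) := by
        gcongr
        exact hσ.measure_ball_le hx _
    _ = _ := by
        rw [← ENNReal.ofReal_mul (by positivity)]
        congr 1
        ring

end IsRotInvSphere

lemma lintegral_Ioi_sq_rpow_neg_three_half {K r : ℝ} (hK : 0 ≤ K) (hr : 0 < r) :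
    ∫⁻ v in Set.Ioi (r ^ 2), ENNReal.ofReal (K * v ^ (-(3 / 2) : ℝ)) =
      ENNReal.ofReal (2 * K / r) := by
  have h0 : (0 : ℝ) < r ^ 2 := by positivity
  rw [← ofReal_integral_eq_lintegral_ofReal
    ((integrableOn_Ioi_rpow_of_lt (by norm_num) h0).const_mul K), integral_const_mul,
    integral_Ioi_rpow_of_lt (by norm_num) h0]
  · congr 1
    have : (r ^ 2 : ℝ) ^ (-(3 / 2) + 1 : ℝ) = r⁻¹ := by
      rw [← Real.rpow_natCast, ← Real.rpow_mul hr.le, ← Real.rpow_neg_one]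
      norm_num
    rw [this]
    field_simp
    norm_num
  · filter_upwards [ae_restrict_mem measurableSet_Ioi] with v hv
    have : 0 < v := h0.trans hv
    positivity

namespace IsRotInvSphere

variable {σ : Measure E3}

lemma lintegral_lintegral_triWeight_le (hσ : IsRotInvSphere σ) {M : ℕ} (hM : 0 < M) {τ : ℝ}
    (hτ : 0 < τ) {r : ℝ} (hr : 0 < r) {x : E3} (hx : ‖x‖ = 1) :
    ∫⁻ y, ∫⁻ z, triWeight M τ x y z ∂σ ∂σ ≤
      ENNReal.ofReal (5 * τ / 8 * r ^ 2 + 40 * τ ^ 2 / √M / r + 64 * τ ^ 2 * exp (-(M / 16))) := by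
  have := hσ.prob
  have hM' : (0 : ℝ) < M := by exact_mod_cast hM
  set A : ℝ := 5 * τ / 4 with hA
  set K : ℝ := 40 * τ ^ 2 / √M with hK
  have hK0 : 0 ≤ K := by positivity
  set T : ℝ := 64 * τ ^ 2 * exp (-(M / 16)) with hT
  set g : ℝ → ENNReal := fun v => (Set.Icc 0 (r ^ 2)).indicator (fun _ => ENNReal.ofReal A) v +
    (Set.Ioi (r ^ 2)).indicator (fun v => ENNReal.ofReal (K * v ^ (-(3 / 2) : ℝ))) v with hg
  have hgm : Measurable g := by
    refine (measurable_const.indicator measurableSet_Icc).add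
      (Measurable.indicator ?_ measurableSet_Ioi)
    fun_prop
  have hgi : ∫⁻ v, g v = ENNReal.ofReal (A * r ^ 2 + 2 * K / r) := by
    rw [hg, lintegral_add_left (measurable_const.indicator measurableSet_Icc),
      lintegral_indicator_const measurableSet_Icc, lintegral_indicator measurableSet_Ioi,
      lintegral_Ioi_sq_rpow_neg_three_half hK0 hr, Real.volume_Icc, sub_zero,
      ← ENNReal.ofReal_mul (by positivity), ← ENNReal.ofReal_add (by positivity) (by positivity)]
  have key : ∀ y : E3, ‖y‖ = 1 → ∫⁻ z, triWeight M τ x y z ∂σ ≤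
      (Set.Icc (1 / 2 : ℝ) 1).indicator (fun s => g (1 - s)) (inner ℝ x y) +
        ENNReal.ofReal T := by
    intro y hy
    have hyx := norm_sub_sq_eq hx hy
    set s := inner ℝ x y with hs
    have hs1 : s ≤ 1 := by nlinarith [sq_nonneg ‖y - x‖]
    rcases le_or_gt (1 / 2) s with h | h
    · have ha1 : ‖y - x‖ ≤ 1 := by nlinarith [norm_nonneg (y - x)]
      refine le_add_of_le_of_nonneg ?_ zero_le
      rw [Set.indicator_of_mem (show s ∈ Set.Icc (1 / 2) 1 from ⟨h, hs1⟩), hg]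
      rcases le_or_gt (1 - s) (r ^ 2) with h' | h'
      · refine le_add_of_le_of_nonneg ?_ zero_le
        rw [Set.indicator_of_mem (show 1 - s ∈ Set.Icc 0 (r ^ 2) from ⟨by linarith, h'⟩)]
        exact hσ.lintegral_triWeight_le_const M hτ hx hy ha1
      · refine le_add_of_nonneg_of_le zero_le ?_
        have hs0 : 0 < 1 - s := (by positivity : 0 < r ^ 2).trans h'
        rw [Set.indicator_of_mem (show 1 - s ∈ Set.Ioi (r ^ 2) from h')]
        have ha0 : 0 < ‖y - x‖ := by
          rcases (norm_nonneg (y - x)).eq_or_lt with h0 | h0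
          · rw [← h0] at hyx; nlinarith
          · exact h0
        refine (hσ.lintegral_triWeight_le_cube hM hτ hx hy ha0 ha1).trans
          (ENNReal.ofReal_le_ofReal ?_)
        have e1 : (1 - s) ^ (-(3 / 2) : ℝ) = ((√(1 - s)) ^ 3)⁻¹ := by
          rw [Real.rpow_neg hs0.le, Real.sqrt_eq_rpow, ← Real.rpow_natCast,
            ← Real.rpow_mul hs0.le]
          norm_num
        have hq : 0 < √(1 - s) := Real.sqrt_pos.2 hs0
        have e2 : √(1 - s) ≤ ‖y - x‖ := by
          rw [Real.sqrt_le_left (norm_nonneg _)]; linarith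
        have e3 : 2 * √(1 - s) ^ 3 ≤ ‖y - x‖ ^ 3 := by
          have : √(1 - s) ^ 2 = 1 - s := Real.sq_sqrt hs0.le
          calc 2 * √(1 - s) ^ 3 = 2 * (1 - s) * √(1 - s) := by rw [pow_succ, this]; ring
            _ ≤ ‖y - x‖ ^ 2 * ‖y - x‖ := by rw [hyx]; gcongr
            _ = _ := by ring
        rw [e1, ← div_eq_mul_inv, hK]
        calc 80 * τ ^ 2 / √M / ‖y - x‖ ^ 3 ≤ 80 * τ ^ 2 / √M / (2 * √(1 - s) ^ 3) := by gcongr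
          _ = _ := by field_simp; norm_num
    · have ha : 1 ≤ ‖y - x‖ := by nlinarith [norm_nonneg (y - x)]
      exact le_add_of_nonneg_of_le zero_le (hσ.lintegral_triWeight_le_far M τ hx hy ha)
  calc ∫⁻ y, ∫⁻ z, triWeight M τ x y z ∂σ ∂σ
      ≤ ∫⁻ y, ((Set.Icc (1 / 2 : ℝ) 1).indicator (fun s => g (1 - s)) (inner ℝ x y) +
        ENNReal.ofReal T) ∂σ := by
        refine lintegral_mono_ae ?_
        filter_upwards [hσ.ae_norm] with y hy using key y hy
    _ = ∫⁻ y, (Set.Icc (1 / 2 : ℝ) 1).indicator (fun s => g (1 - s)) (inner ℝ x y) ∂σ +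
        ENNReal.ofReal T := by
        rw [lintegral_add_right _ measurable_const, lintegral_const, measure_univ, mul_one]
    _ ≤ 2⁻¹ * (∫⁻ s in Set.Icc (1 / 2 : ℝ) 1, g (1 - s)) + ENNReal.ofReal T := by
        gcongr
        exact hσ.lintegral_inner_le hx (by fun_prop) measurableSet_Icc
          fun z hz => (by norm_num : (0 : ℝ) ≤ 1 / 2).trans hz.1
    _ ≤ 2⁻¹ * (∫⁻ s, g (1 - s)) + ENNReal.ofReal T := by
        gcongr
        exact Measure.restrict_le_self
    _ = 2⁻¹ * ENNReal.ofReal (A * r ^ 2 + 2 * K / r) + ENNReal.ofReal T := by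
        rw [lintegral_sub_left_eq_self g, hgi]
    _ = _ := by
        rw [← ENNReal.ofReal_ofNat 2, ← ENNReal.ofReal_inv_of_pos (by norm_num),
          ← ENNReal.ofReal_mul (by norm_num),
          ← ENNReal.ofReal_add (by positivity) (by positivity)]
        congr 1
        rw [hA]
        ring

end IsRotInvSphere

/-- All points `w m` lie in the same closed half-space bounded by the plane through `x` with
normal `n`. -/
def OneSided {ι : Type*} (n x : E3) (w : ι → E3) : Prop :=
  (∀ m, inner ℝ n (w m - x) ≤ 0) ∨ ∀ m, 0 ≤ inner ℝ n (w m - x)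

lemma lintegral_pi_fin_succ {α : Type*} [MeasurableSpace α] (μ : Measure α) [SigmaFinite μ]
    (n : ℕ) {f : (Fin (n + 1) → α) → ENNReal} (hf : Measurable f) :
    ∫⁻ w, f w ∂(Measure.pi fun _ : Fin (n + 1) => μ) =
      ∫⁻ x, ∫⁻ w, f (Fin.cons x w) ∂(Measure.pi fun _ : Fin n => μ) ∂μ := by
  have h := (measurePreserving_piFinSuccAbove (fun _ : Fin (n + 1) => μ) 0).symm
  rw [← h.lintegral_comp hf]
  refine (lintegral_prod _ (hf.comp h.measurable).aemeasurable).trans ?_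
  simp [MeasurableEquiv.piFinSuccAbove, Fin.insertNthEquiv]

lemma indicator_one_eq_of_mem_iff {α β : Type*} {s : Set α} {t : Set β} {a : α} {b : β}
    (h : a ∈ s ↔ b ∈ t) :
    s.indicator (1 : α → ENNReal) a = t.indicator (1 : β → ENNReal) b := by
  classical
  simp only [Set.indicator_apply, h, Pi.one_apply]

lemma measurableSet_isSmallTriangle_and_oneSided {α ι : Type*} [Countable ι]
    [MeasurableSpace α] (τ : ℝ)
    {x y z : α → E3} {w : α → ι → E3} (hx : Measurable x) (hy : Measurable y)
    (hz : Measurable z) (hw : Measurable w) :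
    MeasurableSet {a | IsSmallTriangle τ (x a) (y a) (z a) ∧
      OneSided (triNormal (x a) (y a) (z a)) (x a) (w a)} := by
  have hn : Measurable fun a => triNormal (x a) (y a) (z a) :=
    continuous_cross.measurable.comp ((hy.sub hx).prodMk (hz.sub hx))
  have hm : ∀ m, Measurable fun a => inner ℝ (triNormal (x a) (y a) (z a)) (w a m - x a) :=
    fun m => hn.inner (((measurable_pi_apply m).comp hw).sub hx)
  have hyx : Measurable fun a => ‖y a - x a‖ := (hy.sub hx).norm
  have hzx : Measurable fun a => ‖z a - x a‖ := (hz.sub hx).norm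
  have hzy : Measurable fun a => ‖z a - y a‖ := (hz.sub hy).norm
  have h₁ : MeasurableSet {a | triNormal (x a) (y a) (z a) ≠ 0} :=
    hn (measurableSet_singleton 0).compl
  have h₂ : MeasurableSet {a | IsSmallTriangle τ (x a) (y a) (z a)} :=
    h₁.inter ((measurableSet_le hn.norm measurable_const).inter
      ((measurableSet_le hzy hyx).inter (measurableSet_le hzx hzy)))
  have h₃ : MeasurableSet
      {a | ∀ m, inner ℝ (triNormal (x a) (y a) (z a)) (w a m - x a) ≤ 0} := by
    rw [Set.ofPred_forall]
    exact MeasurableSet.iInter fun m => measurableSet_le (hm m) measurable_const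
  have h₄ : MeasurableSet
      {a | ∀ m, 0 ≤ inner ℝ (triNormal (x a) (y a) (z a)) (w a m - x a)} := by
    rw [Set.ofPred_forall]
    exact MeasurableSet.iInter fun m => measurableSet_le measurable_const (hm m)
  exact h₂.inter (h₃.union h₄)

namespace IsRotInvSphere

variable {σ : Measure E3}

lemma measure_halfSpace_le (hσ : IsRotInvSphere σ) {e : E3} (he : ‖e‖ = 1) {h : ℝ}
    (hh : h ^ 2 ≤ 1) :
    σ {y | inner ℝ e y ≤ h} ≤ ENNReal.ofReal (exp (-((1 - h ^ 2) / 4))) := by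
  have := hσ.prob
  have h1 : 1 - (1 - h ^ 2) / 4 ≤ exp (-((1 - h ^ 2) / 4)) := by
    have := Real.add_one_le_exp (-((1 - h ^ 2) / 4))
    linarith
  refine le_trans ?_ (ENNReal.ofReal_le_ofReal h1)
  rcases eq_or_lt_of_le (show h ≤ 1 by nlinarith) with rfl | hlt
  · simpa using prob_le_one
  set s := (1 + h ^ 2) / 2 with hs
  have hm : MeasurableSet {y : E3 | s ≤ inner ℝ e y} :=
    measurableSet_le measurable_const (by fun_prop)
  calc σ {y | inner ℝ e y ≤ h} ≤ σ {y : E3 | s ≤ inner ℝ e y}ᶜ := by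
        refine measure_mono fun y hy hy' => ?_
        have h1 : inner ℝ e y ≤ h := hy
        have h2 : s ≤ inner ℝ e y := hy'
        nlinarith
    _ = 1 - ENNReal.ofReal ((1 - s) / 2) := by
        rw [prob_compl_eq_one_sub hm, hσ.measure_cap he (by positivity) (by rw [hs]; linarith)]
    _ = ENNReal.ofReal (1 - (1 - h ^ 2) / 4) := by
        rw [← ENNReal.ofReal_one, ← ENNReal.ofReal_sub _ (by rw [hs]; linarith), hs]
        congr 1
        ring

lemma measure_side_le (hσ : IsRotInvSphere σ) {n x : E3} (hn : n ≠ 0) (hx : ‖x‖ = 1) :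
    σ {y | inner ℝ n (y - x) ≤ 0} ≤
      ENNReal.ofReal (exp (-((1 - (inner ℝ n x / ‖n‖) ^ 2) / 4))) := by
  have hn0 : 0 < ‖n‖ := norm_pos_iff.2 hn
  have he : ‖(‖n‖⁻¹ • n)‖ = 1 := by
    rw [norm_smul, norm_inv, norm_norm, inv_mul_cancel₀ hn0.ne']
  refine le_trans (measure_mono fun y hy => ?_) (hσ.measure_halfSpace_le he ?_)
  · have h1 : inner ℝ n (y - x) ≤ 0 := hy
    rw [inner_sub_right] at h1
    show inner ℝ (‖n‖⁻¹ • n) y ≤ _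
    rw [real_inner_smul_left, inv_mul_eq_div]
    gcongr
    linarith
  · have := abs_real_inner_le_norm n x
    rw [hx, mul_one] at this
    rw [div_pow, div_le_one (by positivity)]
    exact sq_le_sq.2 (by rwa [abs_norm])

lemma pi_oneSided_le (hσ : IsRotInvSphere σ) (M : ℕ) {x y z : E3} (hn : triNormal x y z ≠ 0)
    (hx : ‖x‖ = 1) :
    (Measure.pi fun _ : Fin M => σ) {w | OneSided (triNormal x y z) x w} ≤
      ENNReal.ofReal (2 * exp (-(M * radiusSq x y z / 4))) := by
  have := hσ.prob
  have key : ∀ n : E3, n ≠ 0 → (inner ℝ n x / ‖n‖) ^ 2 = 1 - radiusSq x y z →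
      (Measure.pi fun _ : Fin M => σ) {w | ∀ m, inner ℝ n (w m - x) ≤ 0} ≤
        ENNReal.ofReal (exp (-(M * radiusSq x y z / 4))) := by
    intro n hn hnr
    have h1 : {w : Fin M → E3 | ∀ m, inner ℝ n (w m - x) ≤ 0} =
        Set.univ.pi fun _ => {y | inner ℝ n (y - x) ≤ 0} := by
      ext w; simp
    rw [h1, Measure.pi_pi, Finset.prod_const, Finset.card_univ, Fintype.card_fin]
    refine (pow_le_pow_left' (hσ.measure_side_le hn hx) M).trans_eq ?_
    rw [← ENNReal.ofReal_pow (exp_pos _).le, ← Real.exp_nat_mul, hnr]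
    congr 2
    ring
  have h2 : {w : Fin M → E3 | OneSided (triNormal x y z) x w} ⊆
      {w | ∀ m, inner ℝ (triNormal x y z) (w m - x) ≤ 0} ∪
        {w | ∀ m, inner ℝ (-triNormal x y z) (w m - x) ≤ 0} := by
    rintro w (h | h)
    · exact Or.inl h
    · exact Or.inr fun m => by rw [inner_neg_left]; linarith [h m]
  refine (measure_mono h2).trans ((measure_union_le _ _).trans ?_)
  rw [two_mul, ENNReal.ofReal_add (exp_pos _).le (exp_pos _).le]
  gcongr
  · exact key _ hn (by rw [radiusSq]; ring)
  · refine key _ (neg_ne_zero.2 hn) ?_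
    rw [radiusSq, inner_neg_left, norm_neg]
    ring

lemma pi_smallTriangle_first_le (hσ : IsRotInvSphere σ) {M : ℕ} (hM : 0 < M) {τ : ℝ}
    (hτ : 0 < τ) {r : ℝ} (hr : 0 < r) :
    (Measure.pi fun _ : Fin (M + 3) => σ) {ξ | IsSmallTriangle τ (ξ 0) (ξ 1) (ξ 2) ∧
        OneSided (triNormal (ξ 0) (ξ 1) (ξ 2)) (ξ 0) fun m : Fin M => ξ m.succ.succ.succ} ≤
      ENNReal.ofReal (5 * τ / 8 * r ^ 2 + 40 * τ ^ 2 / √M / r + 64 * τ ^ 2 * exp (-(M / 16))) := by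
  have := hσ.prob
  set S := {ξ : Fin (M + 3) → E3 | IsSmallTriangle τ (ξ 0) (ξ 1) (ξ 2) ∧
        OneSided (triNormal (ξ 0) (ξ 1) (ξ 2)) (ξ 0) fun m : Fin M => ξ m.succ.succ.succ} with hS
  have hSm : MeasurableSet S := by
    apply measurableSet_isSmallTriangle_and_oneSided <;> fun_prop
  have hmem : ∀ x y z w, (Fin.cons x (Fin.cons y (Fin.cons z w : Fin (M + 1) → E3) :
      Fin (M + 2) → E3) : Fin (M + 3) → E3) ∈ S ↔
      IsSmallTriangle τ x y z ∧ OneSided (triNormal x y z) x w := fun _ _ _ _ => Iff.rfl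
  have hcons : ∀ (k : ℕ) (x : E3), Measurable fun w : Fin k → E3 =>
      (Fin.cons x w : Fin (k + 1) → E3) := fun k x =>
    (Continuous.finCons continuous_const continuous_id).measurable
  have hone : Measurable (S.indicator (1 : (Fin (M + 3) → E3) → ENNReal)) :=
    measurable_one.indicator hSm
  rw [← lintegral_indicator_one hSm, lintegral_pi_fin_succ _ _ hone]
  have hbound : ∀ x, ‖x‖ = 1 → ∫⁻ w, S.indicator (1 : (Fin (M + 3) → E3) → ENNReal)
      (Fin.cons x w) ∂(Measure.pi fun _ : Fin (M + 2) => σ) ≤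
      ENNReal.ofReal
        (5 * τ / 8 * r ^ 2 + 40 * τ ^ 2 / √M / r + 64 * τ ^ 2 * exp (-(M / 16))) := by
    intro x hx
    refine le_trans ?_ (hσ.lintegral_lintegral_triWeight_le hM hτ hr hx)
    refine (lintegral_pi_fin_succ _ _ (hone.comp (hcons _ x))).trans_le ?_
    refine lintegral_mono fun y => ?_
    refine (lintegral_pi_fin_succ _ _ ((hone.comp (hcons _ x)).comp (hcons _ y))).trans_le ?_
    refine lintegral_mono fun z => ?_
    by_cases h : IsSmallTriangle τ x y z
    · rw [triWeight, if_pos h]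
      refine le_trans (le_of_eq ?_) (hσ.pi_oneSided_le M h.1 hx)
      have hT : MeasurableSet {w : Fin M → E3 | OneSided (triNormal x y z) x w} := by
        have := measurableSet_isSmallTriangle_and_oneSided τ (x := fun _ : Fin M → E3 => x)
          (y := fun _ => y) (z := fun _ => z) (w := id) measurable_const measurable_const
          measurable_const measurable_id
        simpa [h] using this
      rw [← lintegral_indicator_one hT]
      refine lintegral_congr fun w => ?_
      exact indicator_one_eq_of_mem_iff ((hmem x y z w).trans (and_iff_right h))
    · refine le_trans (le_of_eq ?_) zero_le
      rw [← lintegral_zero (μ := Measure.pi fun _ : Fin M => σ)]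
      refine lintegral_congr fun w => ?_
      exact Set.indicator_of_notMem (fun hw => h ((hmem x y z w).1 hw).1) _
  calc _ ≤ ∫⁻ _, ENNReal.ofReal (5 * τ / 8 * r ^ 2 + 40 * τ ^ 2 / √M / r +
          64 * τ ^ 2 * exp (-(M / 16))) ∂σ := by
        refine lintegral_mono_ae ?_
        filter_upwards [hσ.ae_norm] with x hx using hbound x hx
    _ = _ := by rw [lintegral_const, measure_univ, mul_one]

lemma pi_smallTriangle_le (hσ : IsRotInvSphere σ) {M : ℕ} (hM : 0 < M) {τ : ℝ}
    (hτ : 0 < τ) {r : ℝ} (hr : 0 < r) {i j k : Fin (M + 3)} (hij : i ≠ j) (hik : i ≠ k)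
    (hjk : j ≠ k) :
    (Measure.pi fun _ : Fin (M + 3) => σ) {ξ | IsSmallTriangle τ (ξ i) (ξ j) (ξ k) ∧
        OneSided (triNormal (ξ i) (ξ j) (ξ k)) (ξ i) ξ} ≤
      ENNReal.ofReal (5 * τ / 8 * r ^ 2 + 40 * τ ^ 2 / √M / r + 64 * τ ^ 2 * exp (-(M / 16))) := by
  have := hσ.prob
  obtain ⟨g, hg⟩ := Equiv.Perm.exists_extending_pair (![0, 1, 2] : Fin 3 → Fin (M + 3))
    ![i, j, k] (by
      intro a b
      fin_cases a <;> fin_cases b <;> simp [Fin.ext_iff, Nat.mod_eq_of_lt]) (by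
      intro a b
      fin_cases a <;> fin_cases b <;> simp [hij, hik, hjk, hij.symm, hik.symm, hjk.symm])
  have h0 : g 0 = i := hg 0
  have h1 : g 1 = j := hg 1
  have h2 : g 2 = k := hg 2
  have hp := (measurePreserving_piCongrLeft (fun _ : Fin (M + 3) => σ) g).symm
  have happ : ∀ (ξ : Fin (M + 3) → E3) m,
      (MeasurableEquiv.piCongrLeft (fun _ => E3) g).symm ξ m = ξ (g m) := fun _ _ => rfl
  refine (measure_mono ?_).trans ((hp.measure_preimage_equiv _).trans_le
    (hσ.pi_smallTriangle_first_le hM hτ hr))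
  intro ξ hξ
  simp only [Set.mem_preimage, Set.mem_ofPred_eq, happ, h0, h1, h2]
  exact ⟨hξ.1, hξ.2.imp (fun h m => h _) fun h m => h _⟩

lemma pi_exists_smallTriangle_le (hσ : IsRotInvSphere σ) {M : ℕ} (hM : 0 < M) {τ : ℝ}
    (hτ : 0 < τ) {r : ℝ} (hr : 0 < r) :
    (Measure.pi fun _ : Fin (M + 3) => σ) {ξ | ∃ i j k, i ≠ j ∧ i ≠ k ∧ j ≠ k ∧
        IsSmallTriangle τ (ξ i) (ξ j) (ξ k) ∧
        OneSided (triNormal (ξ i) (ξ j) (ξ k)) (ξ i) ξ} ≤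
      ENNReal.ofReal (((M + 3 : ℕ) : ℝ) ^ 3 *
        (5 * τ / 8 * r ^ 2 + 40 * τ ^ 2 / √M / r + 64 * τ ^ 2 * exp (-(M / 16)))) := by
  set B := 5 * τ / 8 * r ^ 2 + 40 * τ ^ 2 / √M / r + 64 * τ ^ 2 * exp (-(M / 16)) with hB
  set E : Fin (M + 3) × Fin (M + 3) × Fin (M + 3) → Set (Fin (M + 3) → E3) := fun p =>
    {ξ | p.1 ≠ p.2.1 ∧ p.1 ≠ p.2.2 ∧ p.2.1 ≠ p.2.2 ∧
        IsSmallTriangle τ (ξ p.1) (ξ p.2.1) (ξ p.2.2) ∧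
        OneSided (triNormal (ξ p.1) (ξ p.2.1) (ξ p.2.2)) (ξ p.1) ξ} with hE
  calc _ ≤ (Measure.pi fun _ : Fin (M + 3) => σ) (⋃ p, E p) := by
        refine measure_mono ?_
        rintro ξ ⟨i, j, k, h⟩
        exact Set.mem_iUnion.2 ⟨(i, j, k), h⟩
    _ ≤ ∑ p, (Measure.pi fun _ : Fin (M + 3) => σ) (E p) := measure_iUnion_fintype_le _ _
    _ ≤ ∑ _p : Fin (M + 3) × Fin (M + 3) × Fin (M + 3), ENNReal.ofReal B := by
        gcongr with p
        by_cases h : p.1 ≠ p.2.1 ∧ p.1 ≠ p.2.2 ∧ p.2.1 ≠ p.2.2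
        · exact (measure_mono fun ξ hξ => hξ.2.2.2).trans
            (hσ.pi_smallTriangle_le hM hτ hr h.1 h.2.1 h.2.2)
        · have : E p = ∅ := Set.eq_empty_of_forall_notMem fun ξ hξ =>
            h ⟨hξ.1, hξ.2.1, hξ.2.2.1⟩
          simp [this]
    _ = _ := by
        rw [Finset.sum_const, Finset.card_univ, Fintype.card_prod, Fintype.card_prod,
          Fintype.card_fin, nsmul_eq_mul, ENNReal.ofReal_mul (by positivity),
          ← ENNReal.ofReal_natCast]
        congr 2
        push_cast
        ring

end IsRotInvSphere

lemma ofReal_norm_triNormal_div_four_le (p q r : E3) :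
    ENNReal.ofReal (‖triNormal p q r‖ / 4) ≤ μH[(2 : ℝ)] (convexHull ℝ {p, q, r}) := by
  rcases eq_or_ne (triNormal p q r) 0 with h0 | h0
  · simp [h0]
  set u := q - p with hu
  set v := r - p with hv
  set n := triNormal p q r with hn
  have hn' : n = cross u v := rfl
  have hn0 : 0 < ‖n‖ := norm_pos_iff.2 h0
  have hu0 : 0 < ‖u‖ := by
    rw [norm_pos_iff]
    rintro h
    have := norm_cross_sq u v
    rw [← hn', h] at this
    simp at this
    exact h0 this
  set w := cross n u with hw
  have hwn : ‖w‖ = ‖n‖ * ‖u‖ := by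
    have h1 := norm_cross_sq n u
    have h2 : inner ℝ n u = 0 := inner_cross_left u v
    rw [h2] at h1
    rw [← sq_eq_sq₀ (norm_nonneg _) (by positivity), hw, h1]
    ring
  have hwv : inner ℝ w v = ‖n‖ ^ 2 := by
    rw [hw, norm_sq_eq_three, hn']
    simp only [inner_eq_three, cross_zero, cross_one, cross_two]
    ring
  have hwu : inner ℝ w u = 0 := inner_cross_right n u
  set φ : E3 → (Fin 2 → ℝ) := fun x =>
    ![inner ℝ u (x - p) / ‖u‖, inner ℝ w (x - p) / ‖w‖] with hφ
  have hdir : ∀ (a x y : E3), |inner ℝ a (x - p) / ‖a‖ - inner ℝ a (y - p) / ‖a‖| ≤ dist x y := by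
    intro a x y
    rw [← sub_div, ← inner_sub_right, sub_sub_sub_cancel_right, abs_div, abs_norm, dist_eq_norm]
    refine div_le_of_le_mul₀ (norm_nonneg _) (norm_nonneg _) ?_
    rw [mul_comm]
    exact abs_real_inner_le_norm a _
  have hlip : LipschitzWith 1 φ := by
    refine LipschitzWith.of_dist_le_mul fun x y => ?_
    rw [NNReal.coe_one, one_mul, dist_pi_le_iff dist_nonneg]
    intro i
    fin_cases i
    · exact hdir u x y
    · exact hdir w x y
  set A : Matrix (Fin 2) (Fin 2) ℝ := !![‖u‖, inner ℝ u v / ‖u‖; 0, ‖n‖ / ‖u‖] with hA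
  have hdet : LinearMap.det (Matrix.toLin' A) = ‖n‖ := by
    rw [LinearMap.det_toLin', Matrix.det_fin_two, hA]
    simp
    field_simp
  have hsub : Matrix.toLin' A '' Set.Icc 0 (fun _ => 1 / 2) ⊆ φ '' convexHull ℝ {p, q, r} := by
    rintro _ ⟨s, hs, rfl⟩
    have h00 := hs.1 0
    have h01 := hs.1 1
    have h10 := hs.2 0
    have h11 := hs.2 1
    simp only [Pi.zero_apply] at h00 h01
    refine ⟨(1 - s 0 - s 1) • p + s 0 • q + s 1 • r, ?_, ?_⟩
    · have h : ∑ i, (![1 - s 0 - s 1, s 0, s 1] : Fin 3 → ℝ) i • (![p, q, r] : Fin 3 → E3) i ∈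
          convexHull ℝ ({p, q, r} : Set E3) := by
        refine (convex_convexHull ℝ _).sum_mem (fun i _ => ?_) ?_ fun i _ => ?_
        · fin_cases i
          · show 0 ≤ 1 - s 0 - s 1
            linarith
          · exact h00
          · exact h01
        · simp only [Fin.sum_univ_three, Matrix.cons_val]
          ring
        · refine subset_convexHull ℝ _ ?_
          fin_cases i <;> simp
      simpa [Fin.sum_univ_three] using h
    · have e : (1 - s 0 - s 1) • p + s 0 • q + s 1 • r - p = s 0 • u + s 1 • v := by
        rw [hu, hv]; module
      ext i
      fin_cases i
      · simp [hφ, e, hA, inner_add_right, real_inner_smul_right, Matrix.mulVec, dotProduct,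
          Fin.sum_univ_two]
        field_simp
      · simp [hφ, e, hA, inner_add_right, real_inner_smul_right, Matrix.mulVec, dotProduct,
          Fin.sum_univ_two, hwu, hwv, hwn]
        field_simp
  have hvol : (volume : Measure (Fin 2 → ℝ)) = μH[(2 : ℝ)] := by
    rw [← hausdorffMeasure_pi_real, Fintype.card_fin, Nat.cast_ofNat]
  calc ENNReal.ofReal (‖n‖ / 4)
      = volume (Matrix.toLin' A '' Set.Icc 0 (fun _ => 1 / 2)) := by
        rw [Measure.addHaar_image_linearMap, hdet, Real.volume_Icc_pi, Fin.prod_univ_two,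
          ← ENNReal.ofReal_mul (by norm_num), ← ENNReal.ofReal_mul (by positivity), abs_norm]
        congr 1
        norm_num
        ring
    _ ≤ volume (φ '' convexHull ℝ {p, q, r}) := measure_mono hsub
    _ ≤ _ := by
        rw [hvol]
        simpa using hlip.hausdorffMeasure_image_le (d := 2) (by norm_num) (convexHull ℝ {p, q, r})

lemma hausdorffMeasure_two_lt_top {F : Set E3} (hb : Bornology.IsBounded F)
    (hF : Module.finrank ℝ (vectorSpan ℝ F) = 2) : μH[(2 : ℝ)] F < ⊤ := by
  rcases F.eq_empty_or_nonempty with rfl | ⟨p, hp⟩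
  · simp
  set V := vectorSpan ℝ F with hV
  have hiso : Isometry fun v : V => p + (v : E3) :=
    Isometry.of_dist_eq fun v w => by rw [dist_add_left, Subtype.dist_eq]
  obtain ⟨R, hR⟩ := hb.subset_closedBall p
  have hsub : F ⊆ (fun v : V => p + (v : E3)) '' closedBall 0 R := by
    intro x hx
    refine ⟨⟨x - p, vsub_mem_vectorSpan ℝ hx hp⟩, ?_, by simp⟩
    have := hR hx
    simpa [dist_eq_norm] using this
  have hfin : μH[(2 : ℝ)] (closedBall (0 : V) R) < ⊤ := by
    have h2 : ((Module.finrank ℝ V : ℕ) : ℝ) = 2 := by rw [hF]; norm_num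
    rw [← h2]
    exact (isCompact_closedBall _ _).measure_lt_top
  calc _ ≤ μH[(2 : ℝ)] ((fun v : V => p + (v : E3)) '' closedBall 0 R) := measure_mono hsub
    _ = μH[(2 : ℝ)] (closedBall (0 : V) R) :=
        hiso.hausdorffMeasure_image (Or.inl (by norm_num)) _
    _ < ⊤ := hfin

lemma exists_eq_smul_of_cross_eq_zero {u v : E3} (hu : u ≠ 0) (h : cross u v = 0) :
    ∃ s : ℝ, v = s • u := by
  have hu0 : 0 < ‖u‖ := norm_pos_iff.2 hu
  refine ⟨inner ℝ u v / ‖u‖ ^ 2, ?_⟩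
  have h1 := norm_cross_sq u v
  rw [h, norm_zero] at h1
  have h2 : ‖v - (inner ℝ u v / ‖u‖ ^ 2) • u‖ ^ 2 = 0 := by
    rw [norm_sub_sq_real, real_inner_smul_right, norm_smul, Real.norm_eq_abs, mul_pow, sq_abs,
      real_inner_comm u v]
    field_simp
    linarith
  rwa [sq_eq_zero_iff, norm_eq_zero, sub_eq_zero] at h2

lemma cross_triple (w a b : E3) :
    cross w (cross a b) = inner ℝ w b • a - inner ℝ w a • b := by
  ext i
  fin_cases i <;> simp [inner_eq_three] <;> ring

lemma triNormal_swap_left (x y z : E3) : triNormal y x z = -triNormal x y z := by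
  ext i
  fin_cases i <;> simp [triNormal] <;> ring

lemma triNormal_swap_right (x y z : E3) : triNormal x z y = -triNormal x y z := by
  ext i
  fin_cases i <;> simp [triNormal] <;> ring

lemma triNormal_self_left (x z : E3) : triNormal x x z = 0 := by
  ext i
  fin_cases i <;> simp [triNormal]

lemma triNormal_self_right (x y : E3) : triNormal x y y = 0 := by
  ext i
  fin_cases i <;> simp [triNormal] <;> ring

lemma triNormal_self_outer (x y : E3) : triNormal x y x = 0 := by
  rw [triNormal_swap_right, triNormal_self_left, neg_zero]

/-- A vector orthogonal to two sides of a non-degenerate triangle is a multiple of its normal. -/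
lemma exists_eq_smul_triNormal {w p q r : E3} (hn : triNormal p q r ≠ 0)
    (hq : inner ℝ w (q - p) = 0) (hr : inner ℝ w (r - p) = 0) :
    ∃ s : ℝ, w = s • triNormal p q r := by
  refine exists_eq_smul_of_cross_eq_zero hn ?_
  have h : cross w (triNormal p q r) = 0 := by
    rw [triNormal, cross_triple, hq, hr]; simp
  ext i
  have h0 := congrArg (fun x : E3 => x 0) h
  have h1 := congrArg (fun x : E3 => x 1) h
  have h2 := congrArg (fun x : E3 => x 2) h
  simp only [cross_zero, cross_one, cross_two, PiLp.zero_apply] at h0 h1 h2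
  fin_cases i <;> simp <;> linarith

/-- The vertices of a triangle can be relabelled so that its sides are in decreasing order. -/
lemma exists_sorted_triangle {S : Set E3} {x y z : E3} (hx : x ∈ S) (hy : y ∈ S) (hz : z ∈ S)
    (h : triNormal x y z ≠ 0) :
    ∃ p ∈ S, ∃ q ∈ S, ∃ r ∈ S, triNormal p q r ≠ 0 ∧ ‖r - q‖ ≤ ‖q - p‖ ∧ ‖r - p‖ ≤ ‖r - q‖ := by
  have hyxz : triNormal y x z ≠ 0 := by rwa [triNormal_swap_left, neg_ne_zero]
  have hxzy : triNormal x z y ≠ 0 := by rwa [triNormal_swap_right, neg_ne_zero]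
  have hyzx : triNormal y z x ≠ 0 := by rwa [triNormal_swap_right, neg_ne_zero]
  have hzxy : triNormal z x y ≠ 0 := by rwa [triNormal_swap_left, neg_ne_zero]
  have hzyx : triNormal z y x ≠ 0 := by rwa [triNormal_swap_left, neg_ne_zero]
  have hxy := norm_sub_rev x y
  have hxz := norm_sub_rev x z
  have hyz := norm_sub_rev y z
  rcases le_total ‖y - x‖ ‖z - y‖ with hab | hab
  · rcases le_total ‖z - y‖ ‖z - x‖ with hbc | hbc
    · exact ⟨x, hx, z, hz, y, hy, hxzy, by linarith, by linarith⟩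
    · rcases le_total ‖y - x‖ ‖z - x‖ with hac | hac
      · exact ⟨y, hy, z, hz, x, hx, hyzx, by linarith, by linarith⟩
      · exact ⟨z, hz, y, hy, x, hx, hzyx, by linarith, by linarith⟩
  · rcases le_total ‖z - x‖ ‖y - x‖ with hca | hca
    · rcases le_total ‖z - x‖ ‖z - y‖ with hcb | hcb
      · exact ⟨x, hx, y, hy, z, hz, h, by linarith, by linarith⟩
      · exact ⟨y, hy, x, hx, z, hz, hyxz, by linarith, by linarith⟩
    · exact ⟨z, hz, x, hx, y, hy, hzxy, by linarith, by linarith⟩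

lemma exists_triNormal_ne_zero {Q : Set E3} (h : ¬ Collinear ℝ Q) :
    ∃ p ∈ Q, ∃ q ∈ Q, ∃ r ∈ Q, triNormal p q r ≠ 0 := by
  by_contra! hcon
  refine h ?_
  rcases Q.eq_empty_or_nonempty with rfl | ⟨p, hp⟩
  · exact collinear_empty ℝ E3
  rw [collinear_iff_of_mem hp]
  by_cases hq : ∃ q ∈ Q, q ≠ p
  · obtain ⟨q, hq, hqp⟩ := hq
    refine ⟨q - p, fun r hr => ?_⟩
    obtain ⟨s, hs⟩ := exists_eq_smul_of_cross_eq_zero (sub_ne_zero.2 hqp) (hcon p hp q hq r hr)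
    exact ⟨s, by rw [← hs]; simp⟩
  · push Not at hq
    exact ⟨0, fun r hr => ⟨0, by simp [hq r hr]⟩⟩

lemma IsExposed.subset_convexHull_inter {ι : Type*} [Finite ι] {ξ : ι → E3} {F : Set E3}
    (hF : IsExposed ℝ (convexHull ℝ (Set.range ξ)) F) :
    F ⊆ convexHull ℝ (F ∩ Set.range ξ) := by
  have hfin := Set.finite_range ξ
  have hc : IsCompact F := hF.isCompact (hfin.isCompact_convexHull ℝ)
  have hconv : Convex ℝ F := hF.convex (convex_convexHull ℝ _)
  have hQ : IsClosed (convexHull ℝ (F ∩ Set.range ξ)) :=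
    (hfin.subset Set.inter_subset_right).isClosed_convexHull ℝ
  have h1 := closure_convexHull_extremePoints hc hconv
  have h2 : F.extremePoints ℝ ⊆ F ∩ Set.range ξ := fun x hx =>
    ⟨hx.1, extremePoints_convexHull_subset (hF.isExtreme.extremePoints_subset_extremePoints hx)⟩
  calc F = closure (convexHull ℝ (F.extremePoints ℝ)) := h1.symm
    _ ⊆ _ := closure_minimal (convexHull_mono h2) hQ

lemma not_collinear_of_finrank {Q F : Set E3} (hFQ : F ⊆ convexHull ℝ Q)
    (hF : Module.finrank ℝ (vectorSpan ℝ F) = 2) : ¬ Collinear ℝ Q := by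
  rw [collinear_iff_finrank_le_one]
  intro h
  have h1 : vectorSpan ℝ F ≤ vectorSpan ℝ Q := by
    rw [← direction_affineSpan ℝ F, ← direction_affineSpan ℝ Q]
    exact AffineSubspace.direction_le
      (affineSpan_le.2 (hFQ.trans (convexHull_subset_affineSpan Q)))
  have := Submodule.finrank_mono h1
  omega

lemma OneSided.of_smul {ι : Type*} {n p : E3} {ξ : ι → E3} {s : ℝ} (hs : s ≠ 0)
    (h : ∀ m, inner ℝ (s • n) (ξ m - p) ≤ 0) : OneSided n p ξ := by
  simp only [real_inner_smul_left] at h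
  rcases hs.lt_or_gt with hs | hs
  · exact Or.inr fun m => nonneg_of_mul_nonpos_right (h m) hs
  · exact Or.inl fun m => nonpos_of_mul_nonpos_right (h m) hs

lemma IsFacet3.oneSided {ι : Type*} {ξ : ι → E3} {F : Set E3}
    (hF : IsFacet3 (convexHull ℝ (Set.range ξ)) F) {p q r : E3} (hp : p ∈ F) (hq : q ∈ F)
    (hr : r ∈ F) (hn : triNormal p q r ≠ 0) : OneSided (triNormal p q r) p ξ := by
  have hξ : ∀ m, ξ m ∈ convexHull ℝ (Set.range ξ) := fun m =>
    subset_convexHull ℝ _ (Set.mem_range_self m)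
  obtain ⟨l, hl⟩ := hF.1 ⟨p, hp⟩
  set w := (InnerProductSpace.toDual ℝ E3).symm l with hw
  have hwl : ∀ x, inner ℝ w x = l x := fun x => InnerProductSpace.toDual_symm_apply
  have hmax : ∀ x ∈ F, ∀ y ∈ convexHull ℝ (Set.range ξ), l y ≤ l x := by
    intro x hx
    rw [hl] at hx
    exact hx.2
  have hsub : ∀ x ∈ F, x ∈ convexHull ℝ (Set.range ξ) := by
    intro x hx
    rw [hl] at hx
    exact hx.1
  have heq : ∀ x ∈ F, inner ℝ w (x - p) = 0 := by
    intro x hx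
    rw [inner_sub_right, hwl, hwl]
    linarith [hmax x hx p (hsub p hp), hmax p hp x (hsub x hx)]
  obtain ⟨s, hs⟩ := exists_eq_smul_triNormal hn (heq q hq) (heq r hr)
  by_cases hs0 : s = 0
  · have hl0 : ∀ x, l x = 0 := fun x => by rw [← hwl, hs, hs0]; simp
    have hFP : ∀ m, ξ m ∈ F := fun m => by
      rw [hl]
      exact ⟨hξ m, fun y _ => by rw [hl0, hl0]⟩
    have hV : (vectorSpan ℝ F)ᗮ ≠ ⊥ := by
      rw [Ne, Submodule.orthogonal_eq_bot_iff]
      intro h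
      have := hF.2
      rw [h, finrank_top, finrank_euclideanSpace_fin] at this
      omega
    obtain ⟨v, hv, hv0⟩ := Submodule.exists_mem_ne_zero_of_ne_bot hV
    have hvF : ∀ x ∈ F, inner ℝ v (x - p) = 0 := fun x hx => by
      rw [real_inner_comm]
      exact hv _ (vsub_mem_vectorSpan ℝ hx hp)
    obtain ⟨c, hc⟩ := exists_eq_smul_triNormal hn (hvF q hq) (hvF r hr)
    refine OneSided.of_smul (s := c) ?_ fun m => ?_
    · rintro rfl
      exact hv0 (by simpa using hc)
    · rw [← hc, hvF _ (hFP m)]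
  · refine OneSided.of_smul hs0 fun m => ?_
    rw [← hs, inner_sub_right, hwl, hwl]
    linarith [hmax p hp _ (hξ m)]

lemma IsFacet3.exists_smallTriangle {ι : Type*} [Finite ι] {ξ : ι → E3} {F : Set E3}
    (hF : IsFacet3 (convexHull ℝ (Set.range ξ)) F) {t : ℝ} (ht : (μH[(2 : ℝ)] F).toReal ≤ t) :
    ∃ i j k, i ≠ j ∧ i ≠ k ∧ j ≠ k ∧ IsSmallTriangle (2 * t) (ξ i) (ξ j) (ξ k) ∧
      OneSided (triNormal (ξ i) (ξ j) (ξ k)) (ξ i) ξ := by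
  obtain ⟨p₀, hp₀, q₀, hq₀, r₀, hr₀, h₀⟩ :=
    exists_triNormal_ne_zero (not_collinear_of_finrank hF.1.subset_convexHull_inter hF.2)
  obtain ⟨_, ⟨hpF, i, rfl⟩, _, ⟨hqF, j, rfl⟩, _, ⟨hrF, k, rfl⟩, hn, h1, h2⟩ :=
    exists_sorted_triangle hp₀ hq₀ hr₀ h₀
  have hconv : Convex ℝ F := hF.1.convex (convex_convexHull ℝ _)
  have hb : Bornology.IsBounded F :=
    (hF.1.isCompact ((Set.finite_range ξ).isCompact_convexHull ℝ)).isBounded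
  have harea : ‖triNormal (ξ i) (ξ j) (ξ k)‖ / 4 ≤ t := by
    refine le_trans ?_ ht
    rw [← ENNReal.ofReal_le_iff_le_toReal (hausdorffMeasure_two_lt_top hb hF.2).ne]
    refine (ofReal_norm_triNormal_div_four_le _ _ _).trans (measure_mono ?_)
    refine convexHull_min ?_ hconv
    rintro x (rfl | rfl | rfl) <;> assumption
  refine ⟨i, j, k, ?_, ?_, ?_, ⟨hn, by linarith, h1, h2⟩, hF.oneSided hpF hqF hrF hn⟩
  · rintro rfl
    exact hn (triNormal_self_left _ _)
  · rintro rfl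
    exact hn (triNormal_self_outer _ _)
  · rintro rfl
    exact hn (triNormal_self_right _ _)

lemma isRotInvSphere_sphereUniform3 (h : sphereUniform3 ≠ 0) : IsRotInvSphere sphereUniform3 := by
  set μ : Measure E3 := μH[(2 : ℝ)] with hμ
  have hS : MeasurableSet (sphere (0 : E3) 1) := isClosed_sphere.measurableSet
  have h0 : μ (sphere 0 1) ≠ 0 := fun h' => h <| by
    rw [sphereUniform3, ← hμ, Measure.restrict_eq_zero.2 h', smul_zero]
  have htop : μ (sphere 0 1) ≠ ⊤ := fun h' => h <| by
    rw [sphereUniform3, ← hμ, h', ENNReal.inv_top, zero_smul]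
  refine ⟨⟨?_⟩, fun g => ?_, ?_⟩
  · rw [sphereUniform3, Measure.smul_apply, Measure.restrict_apply_univ, smul_eq_mul,
      ENNReal.inv_mul_cancel h0 htop]
  · have hg : Measurable g := g.continuous.measurable
    have hmap : μ.map g = μ := g.toIsometryEquiv.map_hausdorffMeasure 2
    have hpre : g ⁻¹' sphere 0 1 = sphere 0 1 := by ext x; simp
    rw [sphereUniform3, Measure.map_smul, ← hμ]
    congr 1
    conv_lhs => rw [← hpre]
    rw [← Measure.restrict_map hg hS, hmap]
  · refine Measure.ae_smul_measure ?_ _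
    filter_upwards [ae_restrict_mem hS] with x hx
    simpa using hx

lemma four_mul_le_exp_div_sixteen {x : ℝ} (hx : 3000 ≤ x) : 4 * (x + 3) ≤ exp (x / 16) := by
  have := Real.quadratic_le_exp_of_nonneg (show 0 ≤ x / 16 by linarith)
  nlinarith

lemma triangle_bound_arith {X Y M : ℝ} (hX : 0 < X) (hX1 : X ≤ 1) (hY : 0 < Y)
    (hYM : Y ^ 3 = M + 3) (hM : 3000 ≤ M) :
    (M + 3) ^ 3 * (5 * (2 * X ^ 3) / 8 * (5 * X / √Y) ^ 2 +
      40 * (2 * X ^ 3) ^ 2 / √M / (5 * X / √Y) + 64 * (2 * X ^ 3) ^ 2 * exp (-(M / 16))) ≤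
      57 * π * Y ^ 8 * X ^ 5 := by
  have hsY : 0 < √Y := Real.sqrt_pos.2 hY
  have hsYsq : √Y ^ 2 = Y := Real.sq_sqrt hY.le
  have hsM : Y * √Y / 2 ≤ √M := by
    refine Real.le_sqrt_of_sq_le ?_
    rw [div_pow, mul_pow, hsYsq]
    have : Y ^ 2 * Y = M + 3 := by rw [← hYM]; ring
    linarith
  have h1 : 5 * (2 * X ^ 3) / 8 * (5 * X / √Y) ^ 2 = 125 / 4 * (X ^ 5 / Y) := by
    rw [div_pow, hsYsq]; ring
  have h2 : 40 * (2 * X ^ 3) ^ 2 / √M / (5 * X / √Y) ≤ 64 * (X ^ 5 / Y) := by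
    calc 40 * (2 * X ^ 3) ^ 2 / √M / (5 * X / √Y)
        ≤ 40 * (2 * X ^ 3) ^ 2 / (Y * √Y / 2) / (5 * X / √Y) := by gcongr
      _ = 64 * (X ^ 5 / Y) := by field_simp; norm_num
  have h3 : 64 * (2 * X ^ 3) ^ 2 * exp (-(M / 16)) ≤ 64 * (X ^ 5 / Y) := by
    have hY1 : Y ≤ M + 3 := by
      rw [← hYM]
      have : 1 ≤ Y := by
        by_contra! h
        have : Y ^ 3 ≤ 1 := pow_le_one₀ hY.le h.le
        linarith
      nlinarith [sq_nonneg (Y - 1), mul_pos hY hY]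
    have hE : exp (-(M / 16)) ≤ 1 / (4 * Y) := by
      rw [exp_neg, ← one_div]
      exact one_div_le_one_div_of_le (by positivity)
        ((by linarith : 4 * Y ≤ 4 * (M + 3)).trans (four_mul_le_exp_div_sixteen hM))
    have hX6 : X ^ 6 ≤ X ^ 5 := pow_le_pow_of_le_one hX.le hX1 (by norm_num)
    calc 64 * (2 * X ^ 3) ^ 2 * exp (-(M / 16)) = 256 * X ^ 6 * exp (-(M / 16)) := by ring
      _ ≤ 256 * X ^ 5 * (1 / (4 * Y)) := by gcongr
      _ = 64 * (X ^ 5 / Y) := by field_simp; norm_num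
  calc _ ≤ (M + 3) ^ 3 * (171 * (X ^ 5 / Y)) := by
        have : 0 < X ^ 5 / Y := by positivity
        gcongr
        linarith
    _ = 57 * 3 * Y ^ 8 * X ^ 5 := by rw [← hYM]; field_simp; norm_num
    _ ≤ _ := by
        gcongr
        exact pi_gt_three.le

theorem small_facet_prob_upper_dim3 :
    ∃ N₀ : ℕ, ∀ N : ℕ, N₀ ≤ N → ∀ t : ℝ, 0 ≤ t →
      (Measure.pi fun _ : Fin N => sphereUniform3)
          {ξ | ∃ F, IsFacet3 (convexHull ℝ (Set.range ξ)) F ∧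
            (μH[(2 : ℝ)] F).toReal ≤ t} ≤
        ENNReal.ofReal (57 * π * (N : ℝ) ^ ((8 : ℝ) / 3) * t ^ ((5 : ℝ) / 3)) := by
  refine ⟨3003, fun N hN t ht => ?_⟩
  obtain ⟨M, rfl⟩ : ∃ M, N = M + 3 := ⟨N - 3, by omega⟩
  have hM : (3000 : ℝ) ≤ M := by exact_mod_cast (by omega : 3000 ≤ M)
  by_cases hzero : sphereUniform3 = 0
  · refine (measure_mono (Set.subset_univ _)).trans ?_
    rw [hzero, Measure.pi_univ]
    simp
  have hσ := isRotInvSphere_sphereUniform3 hzero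
  have := hσ.prob
  have hcast : ((M + 3 : ℕ) : ℝ) = M + 3 := by push_cast; ring
  set Y : ℝ := ((M + 3 : ℕ) : ℝ) ^ ((1 : ℝ) / 3) with hY
  have hY0 : 0 < Y := by positivity
  have hY3 : Y ^ 3 = M + 3 := by
    rw [hY, ← Real.rpow_natCast, ← Real.rpow_mul (by positivity), hcast]
    norm_num
  have hY8 : ((M + 3 : ℕ) : ℝ) ^ ((8 : ℝ) / 3) = Y ^ 8 := by
    rw [hY, ← Real.rpow_natCast, ← Real.rpow_mul (by positivity)]
    norm_num
  set X : ℝ := t ^ ((1 : ℝ) / 3) with hX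
  have hX3 : X ^ 3 = t := by
    rw [hX, ← Real.rpow_natCast, ← Real.rpow_mul ht]
    norm_num
  have hX5 : t ^ ((5 : ℝ) / 3) = X ^ 5 := by
    rw [hX, ← Real.rpow_natCast, ← Real.rpow_mul ht]
    norm_num
  rw [hY8, hX5]
  rcases ht.eq_or_lt with rfl | ht0
  · refine le_of_eq_of_le (measure_mono_null (t := ∅) ?_ measure_empty) zero_le
    rintro ξ ⟨F, hF, hFt⟩
    obtain ⟨i, j, k, -, -, -, h, -⟩ := hF.exists_smallTriangle hFt
    exact (lt_irrefl (0 : ℝ) (by simpa using h.tau_pos)).elim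
  have hX0 : 0 < X := by positivity
  rcases le_or_gt X 1 with hX1 | hX1
  · calc _ ≤ (Measure.pi fun _ : Fin (M + 3) => sphereUniform3)
          {ξ | ∃ i j k, i ≠ j ∧ i ≠ k ∧ j ≠ k ∧ IsSmallTriangle (2 * t) (ξ i) (ξ j) (ξ k) ∧
            OneSided (triNormal (ξ i) (ξ j) (ξ k)) (ξ i) ξ} := by
          refine measure_mono ?_
          rintro ξ ⟨F, hF, hFt⟩
          exact hF.exists_smallTriangle hFt
      _ ≤ _ := hσ.pi_exists_smallTriangle_le (M := M) (by omega) (τ := 2 * t) (by positivity)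
          (r := 5 * X / √Y) (by positivity)
      _ ≤ _ := by
          refine ENNReal.ofReal_le_ofReal ?_
          rw [hcast, ← hX3]
          exact triangle_bound_arith hX0 hX1 hY0 hY3 hM
  · refine prob_le_one.trans ?_
    rw [ENNReal.one_le_ofReal]
    have h1 : 1 ≤ Y ^ 8 := by
      refine one_le_pow₀ ?_
      by_contra! h
      have : Y ^ 3 ≤ 1 := pow_le_one₀ hY0.le h.le
      linarith
    have h2 : 1 ≤ X ^ 5 := one_le_pow₀ hX1.le
    have h3 : 1 ≤ 57 * π := by linarith [pi_gt_three]
    exact one_le_mul_of_one_le_of_one_le (one_le_mul_of_one_le_of_one_le h3 h1) h2
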